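/- Let d ≥ 1 and let c₀ be the minimum of Ω(|G|) (the number of prime factors of |G| counted with multiplicity, i.e. the composition length) taken over all finite solvable groups G of odd order whose derived length equals d. Then log₂ c₀ < d < (γ₀+1)·log₂ c₀ + 2, where γ₀ = 2·log₇ 2. -/

import Mathlib

/-- `Omega n` is the number of prime factors of `n` counted with multiplicity,
usually denoted `Ω(n)`.  For a finite solvable group `G`, `Omega (Nat.card G)`
is the composition length of `G`. -/
def Omega (n : ℕ) : ℕ := n.primeFactorsList.length

/-- `DerivedLengthEq G d` says that the derived (solvable) length of `G` is exactly `d`: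
the `d`-th term of the derived series is trivial and no earlier term is trivial. -/
def DerivedLengthEq (G : Type*) [Group G] (d : ℕ) : Prop :=
  derivedSeries G d = ⊥ ∧ ∀ k < d, derivedSeries G k ≠ ⊥

namespace OddSol

def Bd (i l : ℕ) : Prop := 7 ^ i ≤ 7 * l ^ 2 ∧ (1 ≤ i → 3 ≤ l) ∧ (2 ≤ i → 5 ≤ l)

theorem Bd.mono {i l l' : ℕ} (h : Bd i l) (hl : l ≤ l') : Bd i l' := by
  obtain ⟨h1, h2, h3⟩ := h
  refine ⟨h1.trans (by gcongr), fun h => (h2 h).trans hl, fun h => (h3 h).trans hl⟩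

theorem nine_pow_ge (k : ℕ) (hk : 7 ≤ k) : 343 * k ^ 2 ≤ 9 ^ k := by
  induction k, hk using Nat.le_induction with
  | base => norm_num
  | succ k hk ih => rw [pow_succ 9]; nlinarith

theorem three_pow_ge (k : ℕ) (hk : 8 ≤ k) : 49 * k ^ 2 ≤ 3 ^ k := by
  induction k, hk using Nat.le_induction with
  | base => norm_num
  | succ k hk ih => rw [pow_succ 3]; nlinarith

theorem sq_lt_three_pow (m : ℕ) : m ^ 2 < 3 ^ m := by
  induction m with
  | zero => norm_num
  | succ k ih =>
    rcases k with _ | k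
    · norm_num
    · rw [pow_succ 3]; nlinarith

theorem Bd.seven_le {i l : ℕ} (h : Bd i l) (hi : 3 ≤ i) : 7 ≤ l ∧ 7 ^ (i - 1) ≤ l ^ 2 := by
  obtain ⟨i, rfl⟩ := Nat.exists_eq_add_of_le' hi
  have h1 := h.1
  have e : (7:ℕ) ^ (i + 3) = 7 * (7 ^ i * 49) := by ring
  have e2 : (7:ℕ) ^ (i + 3 - 1) = 7 ^ i * 49 := by
    rw [show i + 3 - 1 = i + 2 by omega]; ring
  have h3 : 7 ^ i * 49 ≤ l ^ 2 := by omega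
  refine ⟨?_, e2 ▸ h3⟩
  have : 1 ≤ 7 ^ i := Nat.one_le_pow _ _ (by norm_num)
  nlinarith

/-- numeric lemma for the regular permutation case -/
theorem num_perm {i k q : ℕ} (hq : 3 ≤ q) (h7 : 7 ≤ q ^ k) (h : Bd i k) :
    7 ^ (i + 2) ≤ (q ^ k) ^ 2 := by
  have hqk : 9 ^ k ≤ (q ^ k) ^ 2 := by
    rw [← pow_mul, mul_comm k 2, pow_mul]
    exact Nat.pow_le_pow_left (by nlinarith) k
  rcases Nat.lt_or_ge i 3 with hi | hi
  · interval_cases i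
    · exact Nat.pow_le_pow_left h7 2
    · have := h.2.1 le_rfl
      have : 9 ^ 3 ≤ 9 ^ k := Nat.pow_le_pow_right (by norm_num) this
      omega
    · have := h.2.2 le_rfl
      have : 9 ^ 5 ≤ 9 ^ k := Nat.pow_le_pow_right (by norm_num) this
      omega
  · obtain ⟨h1, h2⟩ := h.seven_le hi
    have := nine_pow_ge k h1
    have e : (7:ℕ) ^ (i + 2) = 343 * 7 ^ (i - 1) := by
      obtain ⟨i, rfl⟩ := Nat.exists_eq_add_of_le' hi
      rw [show i + 3 - 1 = i + 2 by omega]; ring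
    rw [e]
    calc _ ≤ 343 * k ^ 2 := by gcongr
      _ ≤ _ := this.trans hqk

/-- numeric lemma for the extraspecial case -/
theorem num_lin {i k l q : ℕ} (hq : 3 ≤ q) (hk : 1 ≤ k) (hl : l ≤ 2 * k) (h : Bd i l) :
    7 ^ (i + 1) ≤ (q ^ k) ^ 2 := by
  have hqk : 9 ^ k ≤ (q ^ k) ^ 2 := by
    rw [← pow_mul, mul_comm k 2, pow_mul]
    exact Nat.pow_le_pow_left (by nlinarith) k
  refine le_trans ?_ hqk
  rcases Nat.lt_or_ge i 3 with hi | hi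
  · interval_cases i
    · have : 9 ^ 1 ≤ 9 ^ k := Nat.pow_le_pow_right (by norm_num) hk
      omega
    · have := h.2.1 le_rfl
      have : 9 ^ 2 ≤ 9 ^ k := Nat.pow_le_pow_right (by norm_num) (by omega)
      omega
    · have := h.2.2 le_rfl
      have : 9 ^ 3 ≤ 9 ^ k := Nat.pow_le_pow_right (by norm_num) (by omega)
      omega
  · obtain ⟨h1, h2⟩ := h.seven_le hi
    have h4 : 4 ≤ k := by omega
    have := three_pow_ge (2 * k) (by omega)
    have e : (7:ℕ) ^ (i + 1) = 49 * 7 ^ (i - 1) := by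
      obtain ⟨i, rfl⟩ := Nat.exists_eq_add_of_le' hi
      rw [show i + 3 - 1 = i + 2 by omega]; ring
    rw [e]
    calc _ ≤ 49 * (2 * k) ^ 2 := Nat.mul_le_mul_left _ (h2.trans (Nat.pow_le_pow_left hl 2))
      _ ≤ 3 ^ (2 * k) := this
      _ = _ := by rw [pow_mul]; norm_num

section groups
variable {G : Type*} [Group G]

theorem derived_sub (j k : ℕ) :
    (derivedSeries ↥(derivedSeries G j) k).map (derivedSeries G j).subtype
      = derivedSeries G (j + k) := by
  induction k with
  | zero => rw [derivedSeries_zero, ← MonoidHom.range_eq_map, Subgroup.range_subtype, add_zero]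
  | succ k ih => rw [derivedSeries_succ, Subgroup.map_commutator, ih, ← add_assoc, derivedSeries_succ]

/-- minimal normal subgroup -/
structure MinNormal (V : Subgroup G) : Prop where
  normal : V.Normal
  ne_bot : V ≠ ⊥
  min : ∀ U : Subgroup G, U.Normal → U ≤ V → U = ⊥ ∨ U = V

theorem exists_minNormal [Finite G] (A : Subgroup G) (hA : A.Normal) (h : A ≠ ⊥) :
    ∃ V : Subgroup G, MinNormal V ∧ V ≤ A := by
  obtain ⟨V, hV⟩ := (Set.toFinite {V : Subgroup G | V.Normal ∧ V ≠ ⊥ ∧ V ≤ A}).exists_minimal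
    ⟨A, hA, h, le_rfl⟩
  refine ⟨V, ⟨hV.prop.1, hV.prop.2.1, fun U hU hUV => ?_⟩, hV.prop.2.2⟩
  by_cases hb : U = ⊥
  · exact Or.inl hb
  · exact Or.inr (le_antisymm hUV (hV.le_of_le ⟨hU, hb, hUV.trans hV.prop.2.2⟩ hUV))

theorem MinNormal.comm [Group.IsSolvable G] {V : Subgroup G} (hV : MinNormal V) :
    ∀ x ∈ V, ∀ y ∈ V, x * y = y * x := by
  have := hV.normal
  have hlt := Group.IsSolvable.commutator_lt_of_ne_bot hV.ne_bot
  rcases hV.min ⁅V, V⁆ inferInstance hlt.le with h | h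
  · intro x hx y hy
    rw [Subgroup.commutator_eq_bot_iff_le_centralizer] at h
    exact (Subgroup.mem_centralizer_iff.mp (h hy) x hx)
  · exact absurd h hlt.ne

theorem MinNormal.elem [Finite G] [Group.IsSolvable G] {V : Subgroup G} (hV : MinNormal V) :
    ∃ q l : ℕ, q.Prime ∧ (∀ x ∈ V, x ^ q = 1) ∧ Nat.card V = q ^ l ∧ l ≠ 0 := by
  have hn := hV.normal
  have hcard : Nat.card V ≠ 1 := by
    intro h; exact hV.ne_bot (Subgroup.card_eq_one.mp h)
  set q := (Nat.card V).minFac with hq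
  have hqp : q.Prime := Nat.minFac_prime hcard
  haveI := Fact.mk hqp
  let U : Subgroup G :=
    { carrier := {x | x ∈ V ∧ x ^ q = 1}
      one_mem' := ⟨V.one_mem, one_pow _⟩
      mul_mem' := by
        rintro a b ⟨ha, ha'⟩ ⟨hb, hb'⟩
        refine ⟨V.mul_mem ha hb, ?_⟩
        have : Commute a b := hV.comm a ha b hb
        rw [this.mul_pow, ha', hb', one_mul]
      inv_mem' := by
        rintro a ⟨ha, ha'⟩
        exact ⟨V.inv_mem ha, by rw [inv_pow, ha', inv_one]⟩ }
  have hUV : U ≤ V := fun x hx => hx.1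
  have hUn : U.Normal := ⟨fun x hx g => ⟨hn.conj_mem x hx.1 g, by
    rw [conj_pow, hx.2]; simp⟩⟩
  obtain ⟨x, hx⟩ := exists_prime_orderOf_dvd_card' (G := V) q (Nat.minFac_dvd _)
  have hxU : (x : G) ∈ U := ⟨x.2, by
    have := pow_orderOf_eq_one x
    rw [hx] at this
    exact_mod_cast congrArg Subtype.val this⟩
  have hall : ∀ y ∈ V, y ^ q = 1 := by
    rcases hV.min U hUn hUV with h | h
    · rw [h, Subgroup.mem_bot] at hxU
      have : x = 1 := Subtype.ext hxU
      rw [this, orderOf_one] at hx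
      exact absurd hx hqp.one_lt.ne
    · intro y hy; rw [← h] at hy; exact hy.2
  have hp : IsPGroup q V := fun y => ⟨1, by
    rw [pow_one]; exact Subtype.ext (hall y y.2)⟩
  obtain ⟨l, hl⟩ := IsPGroup.iff_card.mp hp
  refine ⟨q, l, hqp, hall, hl, ?_⟩
  rintro rfl
  exact hcard (by simpa using hl)

end groups
end OddSol

namespace OddSol
open scoped TensorProduct

theorem fixed_fin {q : ℕ} [Fact q.Prime] {S : Type*} [AddCommGroup S] [Finite S] [Nontrivial S]
    (hq : ∀ s : S, q • s = 0) {N : Type*} [Group N] [DistribMulAction N S]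
    (hu : ∀ (n : N) (s : S), ∃ k : ℕ, n ^ (q ^ k) • s = s) :
    ∃ s : S, s ≠ 0 ∧ ∀ n : N, n • s = s := by
  let φ := MulAction.toPermHom N S
  have hP : IsPGroup q φ.range := by
    rintro ⟨_, n, rfl⟩
    choose k hk using hu n
    have := Fintype.ofFinite S
    obtain ⟨M, hM⟩ := (Set.finite_range k).bddAbove
    refine ⟨M, Subtype.ext ?_⟩
    rw [SubmonoidClass.coe_pow, ← map_pow]
    ext s
    change n ^ (q ^ M) • s = s
    have hkM : k s ≤ M := hM ⟨s, rfl⟩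
    obtain ⟨c, rfl⟩ := Nat.exists_eq_add_of_le hkM
    rw [pow_add, pow_mul]
    have h1 : ∀ j : ℕ, (n ^ q ^ k s) ^ j • s = s := by
      intro j
      induction j with
      | zero => simp
      | succ j ih => rw [pow_succ, mul_smul, hk, ih]
    exact h1 _
  have hd : q ∣ Nat.card S := by
    obtain ⟨s, hs⟩ := exists_ne (0 : S)
    have : addOrderOf s = q := addOrderOf_eq_prime (hq s) hs
    rw [← this]
    exact addOrderOf_dvd_natCard s
  obtain ⟨b, hb, hb0⟩ := hP.exists_fixed_point_of_prime_dvd_card_of_fixed_point (α := S) hd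
    (a := 0) (by
      rintro ⟨_, n, rfl⟩
      exact smul_zero n)
  exact ⟨b, hb0.symm, fun n => hb ⟨φ n, n, rfl⟩⟩

section rep
variable {K : Type*} [Field K] {W : Type*} [AddCommGroup W] [Module K W]

/-- locally of `q`-power order -/
def Uni (q : ℕ) (f : Module.End K W) : Prop := ∀ w, ∃ k : ℕ, (f ^ (q ^ k)) w = w

theorem fixed_vec {q : ℕ} [Fact q.Prime] [CharP K q] [Nontrivial W] {N : Type*} [Group N] [Finite N]
    (ρ : Representation K N W) (hu : ∀ n, Uni q (ρ n)) :
    ∃ w : W, w ≠ 0 ∧ ∀ n, ρ n w = w := by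
  obtain ⟨w0, hw0⟩ := exists_ne (0 : W)
  let S : AddSubgroup W := AddSubgroup.closure (Set.range fun n => ρ n w0)
  have hS : ∀ n, ∀ s ∈ S, ρ n s ∈ S := by
    intro n s hs
    induction hs using AddSubgroup.closure_induction with
    | mem x hx =>
      obtain ⟨m, rfl⟩ := hx
      refine AddSubgroup.subset_closure ⟨n * m, ?_⟩
      simp
    | zero => simp
    | add x y _ _ hx hy => rw [map_add]; exact S.add_mem hx hy
    | neg x _ hx => rw [map_neg]; exact S.neg_mem hx
  have hqW : ∀ w : W, q • w = 0 := by
    intro w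
    rw [← Nat.cast_smul_eq_nsmul K, CharP.cast_eq_zero, zero_smul]
  have hfg : AddGroup.FG S := by
    rw [AddGroup.fg_iff_addSubgroup_fg]
    exact AddSubgroup.fg_iff _ |>.mpr ⟨_, rfl, Set.finite_range _⟩
  have hfin : Finite S := by
    apply AddCommGroup.finite_of_fg_isAddTorsion
    intro s
    rw [isOfFinAddOrder_iff_nsmul_eq_zero]
    exact ⟨q, (Fact.out : q.Prime).pos, Subtype.ext (hqW _)⟩
  have hnt : Nontrivial S := ⟨⟨⟨w0, AddSubgroup.subset_closure ⟨1, by simp⟩⟩, 0, by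
    intro h; exact hw0 (congrArg Subtype.val h)⟩⟩
  let act : DistribMulAction N S :=
    { smul := fun n s => ⟨ρ n s, hS n s s.2⟩
      one_smul := fun s => Subtype.ext (by change ρ 1 (s : W) = s; simp)
      mul_smul := fun a b s => Subtype.ext (by change ρ (a * b) (s : W) = ρ a (ρ b s); simp)
      smul_zero := fun a => Subtype.ext (by change ρ a (0 : W) = 0; simp)
      smul_add := fun a s t => Subtype.ext (by
        change ρ a ((s : W) + t) = ρ a s + ρ a t; simp) }
  obtain ⟨s, hs, h⟩ := fixed_fin (q := q) (S := S) (N := N) (fun s => Subtype.ext (hqW _)) (by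
    intro n s
    obtain ⟨k, hk⟩ := hu n s
    refine ⟨k, Subtype.ext ?_⟩
    change ρ (n ^ q ^ k) (s : W) = s
    rw [map_pow, hk])
  exact ⟨s, fun h0 => hs (Subtype.ext h0), fun n => congrArg Subtype.val (h n)⟩

theorem subrep_coe {H : Type*} [Group H] (ρ : Representation K H W) (U : Submodule K W)
    (hU : ∀ g, U ≤ U.comap (ρ g)) (h : H) (u : U) :
    ((ρ.subrepresentation U hU h u : U) : W) = ρ h u := rfl

theorem uni_sub_iff {q : ℕ} {H : Type*} [Group H] (ρ : Representation K H W) (U : Submodule K W)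
    (hU : ∀ g, U ≤ U.comap (ρ g)) (h : H) :
    Uni q (ρ.subrepresentation U hU h) ↔ ∀ u ∈ U, ∃ k : ℕ, (ρ h ^ (q ^ k)) u = u := by
  constructor
  · intro hh u hu
    obtain ⟨k, hk⟩ := hh ⟨u, hu⟩
    refine ⟨k, ?_⟩
    rw [← map_pow] at hk ⊢
    exact congrArg Subtype.val hk
  · intro hh u
    obtain ⟨k, hk⟩ := hh u u.2
    refine ⟨k, ?_⟩
    rw [← map_pow] at hk ⊢
    exact Subtype.ext hk

theorem pow_fix {f : Module.End K W} {w : W} (h : f w = w) (n : ℕ) : (f ^ n) w = w := by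
  induction n with
  | zero => simp
  | succ n ih => rw [pow_succ, Module.End.mul_apply, h, ih]

theorem q_smul {q : ℕ} [CharP K q] (w : W) : q • w = 0 := by
  rw [← Nat.cast_smul_eq_nsmul K, CharP.cast_eq_zero, zero_smul]

theorem uni_ext {q : ℕ} [CharP K q] {H : Type*} [Group H] (ρ : Representation K H W)
    (U : Submodule K W)
    (hU : ∀ g, U ≤ U.comap (ρ g)) (h : H) (h1 : Uni q (ρ.subrepresentation U hU h))
    (h2 : Uni q (ρ.quotient U hU h)) : Uni q (ρ h) := by
  intro w
  obtain ⟨k, hk⟩ := h2 (Submodule.Quotient.mk w)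
  rw [← map_pow] at hk
  have hk' : ρ (h ^ q ^ k) w - w ∈ U := by
    rw [← Submodule.Quotient.eq]
    exact hk
  obtain ⟨j, hj⟩ := (uni_sub_iff ρ U hU h).mp h1 _ hk'
  set f := ρ h with hf
  rw [map_pow, ← hf] at hk' hj
  set a := f ^ q ^ k with ha
  set g := f ^ q ^ (k + j) with hg
  have e1 : g (a w - w) = a w - w := by
    rw [hg, add_comm, pow_add, pow_mul]; exact pow_fix hj _
  have e2 : a (g w - w) = g w - w := by
    have : a (g w) = g (a w) := by
      rw [← Module.End.mul_apply, ← Module.End.mul_apply, ha, hg, ← pow_add, ← pow_add, add_comm]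
    rw [map_sub] at e1 ⊢
    rw [this]
    exact sub_eq_sub_iff_sub_eq_sub.mp e1
  have e3 : g (g w - w) = g w - w := by
    have : g = a ^ q ^ j := by rw [hg, ha, ← pow_mul, ← pow_add]
    rw [this]; rw [this] at e2; exact pow_fix e2 _
  have e4 : ∀ n : ℕ, (g ^ n) w = w + n • (g w - w) := by
    intro n
    induction n with
    | zero => simp
    | succ n ih =>
      rw [pow_succ', Module.End.mul_apply, ih, map_add, map_nsmul, e3, succ_nsmul]
      abel
  refine ⟨k + j + 1, ?_⟩
  rw [pow_succ q, pow_mul, ← hg, e4, q_smul (K := K), add_zero]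

end rep

/-- the linear statement in dimension `m` -/
def LinS (m : ℕ) : Prop :=
  ∀ (q : ℕ) [Fact q.Prime] (K : Type) [Field K] [IsAlgClosed K] [CharP K q]
    (W : Type) [AddCommGroup W] [Module K W] [FiniteDimensional K W], Module.finrank K W = m →
    ∀ (H : Type) [Group H] [Finite H] [Group.IsSolvable H], Odd (Nat.card H) →
    ∀ (ρ : Representation K H W) (s : ℕ) (h : H), h ∈ derivedSeries H s → ¬ Uni q (ρ h) → Bd s m

def zrep (q : ℕ) {S : Type*} [AddCommGroup S] [Module (ZMod q) S] (H : Type*) [Group H]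
    [DistribMulAction H S] : H →* Module.End (ZMod q) S where
  toFun := fun h => (DistribSMul.toAddMonoidHom S h).toZModLinearMap q
  map_one' := LinearMap.ext fun s => one_smul H s
  map_mul' := fun a b => LinearMap.ext fun s => mul_smul a b s

theorem chief_gen {q l : ℕ} [Fact q.Prime] (hL : LinS l) {S : Type} [AddCommGroup S] [Finite S]
    [Nontrivial S] [Module (ZMod q) S] (hq : ∀ s : S, q • s = 0) (hcard : Nat.card S = q ^ l)
    {H : Type} [Group H] [Finite H] [Group.IsSolvable H] (hodd : Odd (Nat.card H))
    [DistribMulAction H S] (i : ℕ) (hn : ∀ s : S, s ≠ 0 → ∃ n ∈ derivedSeries H i, n • s ≠ s) :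
    Bd i l := by
  have h1 : ∃ n : derivedSeries H i, ∃ s : S, ∀ k : ℕ, n ^ (q ^ k) • s ≠ s := by
    by_contra! hc
    obtain ⟨s, hs, h⟩ := fixed_fin (q := q) hq hc
    obtain ⟨n, hn, h'⟩ := hn s hs
    exact h' (h ⟨n, hn⟩)
  obtain ⟨⟨n, hnm⟩, s, hs⟩ := h1
  let ρ := zrep q (S := S) H
  let K := AlgebraicClosure (ZMod q)
  have hch : CharP K q := charP_of_injective_algebraMap (algebraMap (ZMod q) K).injective q
  have hfd : Module.Finite (ZMod q) S := Module.Finite.of_finite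
  let ρK : Representation K H (TensorProduct (ZMod q) K S) :=
    ((Module.End.baseChangeHom (ZMod q) K S : _ →* _)).comp ρ
  have hfr : Module.finrank K (TensorProduct (ZMod q) K S) = l := by
    rw [Module.finrank_baseChange]
    have := Module.natCard_eq_pow_finrank (K := ZMod q) (V := S)
    rw [hcard, Nat.card_zmod] at this
    exact (Nat.pow_right_injective (Fact.out : q.Prime).two_le this).symm
  refine hL q K _ hfr H hodd ρK i n hnm ?_
  intro hu
  obtain ⟨k, hk⟩ := hu (1 ⊗ₜ s)
  apply hs k
  rw [← map_pow] at hk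
  have hk2 : (1 : K) ⊗ₜ[ZMod q] (n ^ q ^ k • s) = 1 ⊗ₜ s := hk
  exact Module.Flat.tensorProduct_mk_injective (R := ZMod q) (S := K) (M := S) hk2

theorem chief_small {q l : ℕ} [Fact q.Prime] {S : Type} [AddCommGroup S] [Finite S]
    [Nontrivial S] [Module (ZMod q) S] (hq : ∀ s : S, q • s = 0) (hcard : Nat.card S = q ^ l)
    (hqo : Odd q)
    {H : Type} [Group H] [Finite H] (hodd : Odd (Nat.card H))
    [DistribMulAction H S] (hn : ∀ s : S, s ≠ 0 → ∃ n : H, n • s ≠ s) :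
    7 ≤ q ^ l ∧ q ^ l ≠ 9 := by
  have hfd : Module.Finite (ZMod q) S := Module.Finite.of_finite
  have hfr : Module.finrank (ZMod q) S = l := by
    have := Module.natCard_eq_pow_finrank (K := ZMod q) (V := S)
    rw [hcard, Nat.card_zmod] at this
    exact (Nat.pow_right_injective (Fact.out : q.Prime).two_le this).symm
  have key : ¬ (Nat.card (Matrix.GeneralLinearGroup (Fin l) (ZMod q)) ∣ 2 ^ 4 * q) := by
    intro hdvd
    obtain ⟨s, hs, h⟩ := fixed_fin (q := q) (N := H) hq (by
      intro h s
      refine ⟨1, ?_⟩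
      let u := (zrep q (S := S) H).toHomUnits h
      have e : (Module.End (ZMod q) S)ˣ ≃* Matrix.GeneralLinearGroup (Fin l) (ZMod q) :=
        Units.mapEquiv (algEquivMatrix (Module.finBasisOfFinrankEq (ZMod q) S hfr)).toMulEquiv
      have h1 : orderOf u ∣ 2 ^ 4 * q := by
        rw [← orderOf_injective e.toMonoidHom e.injective]
        exact (orderOf_dvd_natCard _).trans hdvd
      have h2 : orderOf u ∣ Nat.card H := (orderOf_map_dvd _ h).trans (orderOf_dvd_natCard h)
      have h3 : orderOf u ∣ q := by
        refine Nat.Coprime.dvd_of_dvd_mul_left ?_ h1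
        have : Odd (orderOf u) := hodd.of_dvd_nat h2
        exact (Nat.coprime_two_right.mpr this).pow_right 4
      have h4 : u ^ q = 1 := orderOf_dvd_iff_pow_eq_one.mp h3
      rw [pow_one]
      rw [← map_pow] at h4
      have h5 := congrArg (fun v : (Module.End (ZMod q) S)ˣ => (v : Module.End (ZMod q) S) s) h4
      exact h5)
    obtain ⟨n, h'⟩ := hn s hs
    exact h' (h n)
  have hqp : q.Prime := Fact.out
  have hq3 : 3 ≤ q := by
    have := hqp.two_le
    rcases hqo with ⟨a, rfl⟩; omega
  rw [Matrix.card_GL_field] at key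
  simp only [ZMod.card] at key
  have hl0 : l ≠ 0 := by
    rintro rfl
    have : 1 < Nat.card S := Finite.one_lt_card
    rw [hcard] at this; simp at this
  have hl : l = 1 ∨ l = 2 ∨ 3 ≤ l := by omega
  rcases hl with rfl | rfl | hl
  · simp at key ⊢
    refine ⟨?_, ?_⟩
    · by_contra! hlt
      interval_cases q
      · norm_num at key
      · exact absurd hqo (by decide)
      · norm_num at key
      · exact absurd hqo (by decide)
    · rintro rfl; norm_num at hqp
  · refine ⟨by nlinarith, ?_⟩
    intro h9
    have : q = 3 := by nlinarith
    subst this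
    simp [Fin.prod_univ_two] at key
  · have : 3 ^ 3 ≤ q ^ l :=
      (Nat.pow_le_pow_left hq3 3).trans (Nat.pow_le_pow_right (by omega) hl)
    omega

section
variable {G : Type} [Group G]

/-- conjugation action on an abelian normal subgroup, additively -/
@[reducible] def conjD (V : Subgroup G) [hV : V.Normal] [IsMulCommutative V] :
    DistribMulAction G (Additive V) where
  smul g v := Additive.ofMul ⟨g * (v.toMul : G) * g⁻¹, hV.conj_mem _ v.toMul.2 g⟩
  one_smul v := by
    apply Additive.toMul.injective; apply Subtype.ext
    change 1 * (v.toMul : G) * 1⁻¹ = v.toMul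
    group
  mul_smul a b v := by
    apply Additive.toMul.injective; apply Subtype.ext
    change (a * b) * (v.toMul : G) * (a * b)⁻¹ = a * (b * v.toMul * b⁻¹) * a⁻¹
    group
  smul_zero a := by
    apply Additive.toMul.injective; apply Subtype.ext
    change a * 1 * a⁻¹ = 1
    group
  smul_add a v w := by
    apply Additive.toMul.injective; apply Subtype.ext
    change a * ((v.toMul : G) * w.toMul) * a⁻¹ = (a * v.toMul * a⁻¹) * (a * w.toMul * a⁻¹)
    group

theorem chief [Finite G] [Group.IsSolvable G] (hodd : Odd (Nat.card G)) {V : Subgroup G}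
    (hV : MinNormal V) {q l : ℕ} (hqp : q.Prime) (hel : ∀ x ∈ V, x ^ q = 1)
    (hcard : Nat.card V = q ^ l) (i : ℕ)
    (hnc : ∃ g ∈ derivedSeries G i, ∃ v ∈ V, g * v ≠ v * g) :
    (LinS l → Bd i l) ∧ 7 ≤ q ^ l ∧ q ^ l ≠ 9 ∧ 3 ≤ q := by
  have := hV.normal
  have : Fact q.Prime := ⟨hqp⟩
  have : IsMulCommutative V := ⟨⟨fun a b => Subtype.ext (hV.comm a a.2 b b.2)⟩⟩
  have hne : Nontrivial V := (Subgroup.nontrivial_iff_ne_bot V).mpr hV.ne_bot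
  have hel' : ∀ s : Additive V, q • s = 0 := fun s =>
    Additive.toMul.injective (Subtype.ext (hel _ s.toMul.2))
  let cg : CommGroup V := { (inferInstance : Group V) with
    mul_comm := fun a b => Subtype.ext (hV.comm a a.2 b b.2) }
  let mod : Module (ZMod q) (Additive V) := AddCommGroup.zmodModule hel'
  let act := conjD V
  have hnn : ∀ s : Additive V, s ≠ 0 → ∃ n ∈ derivedSeries G i, n • s ≠ s := by
    intro s hs
    by_contra! hc
    let U : Subgroup G := V ⊓ Subgroup.centralizer (derivedSeries G i)
    rcases hV.min U inferInstance inf_le_left with h | h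
    · have : (s.toMul : G) ∈ U := by
        refine ⟨s.toMul.2, Subgroup.mem_centralizer_iff.mpr fun n hn => ?_⟩
        have := congrArg (fun x : Additive V => (x.toMul : G)) (hc n hn)
        change n * (s.toMul : G) * n⁻¹ = s.toMul at this
        exact mul_inv_eq_iff_eq_mul.mp this
      rw [h, Subgroup.mem_bot] at this
      exact hs (Additive.toMul.injective (Subtype.ext this))
    · obtain ⟨g, hg, v, hv, hgv⟩ := hnc
      rw [← h] at hv
      exact hgv (Subgroup.mem_centralizer_iff.mp hv.2 g hg)
  have hcard' : Nat.card (Additive V) = q ^ l := hcard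
  have hl0 : l ≠ 0 := by
    rintro rfl
    have : 1 < Nat.card V := Finite.one_lt_card
    rw [hcard] at this; simp at this
  have hqo : Odd q := hodd.of_dvd_nat
    (((dvd_pow_self q hl0).trans hcard.symm.dvd).trans (Subgroup.card_subgroup_dvd_card V))
  refine ⟨fun hL => chief_gen hL hel' hcard' hodd i hnn, ?_⟩
  obtain ⟨h1, h2⟩ := chief_small hel' hcard' hqo hodd
    (fun s hs => by obtain ⟨n, _, h⟩ := hnn s hs; exact ⟨n, h⟩)
  refine ⟨h1, h2, ?_⟩
  have := hqp.two_le
  rcases hqo with ⟨a, rfl⟩; omega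
end
end OddSol

namespace OddSol

section wt
variable {K : Type*} [Field K] {W : Type*} [AddCommGroup W] [Module K W]

theorem sum_finrank_le [FiniteDimensional K W] {ι : Type*} [Finite ι] (p : ι → Submodule K W)
    (hp : iSupIndep p) (u : ℕ) (hu : ∀ i, Module.finrank K (p i) = u) :
    Nat.card ι * u ≤ Module.finrank K W := by
  classical
  have := Fintype.ofFinite ι
  have h := hp.dfinsupp_lsum_injective
  have h2 := LinearMap.finrank_le_finrank_of_injective h
  have h3 : Module.finrank K (Π₀ i, p i) = Nat.card ι * u := by
    have := Module.finrank_directSum K (fun i => p i)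
    simp only [hu] at this
    rw [Finset.sum_const, smul_eq_mul, Finset.card_univ, ← Nat.card_eq_fintype_card] at this
    exact this
  rw [← h3]; exact h2

variable {S : Type*} [Group S] (ρ : Representation K S W)

/-- weight space -/
def wt (A : Subgroup S) (χ : A → K) : Submodule K W := ⨅ a : A, Module.End.eigenspace (ρ (a : S)) (χ a)

theorem mem_wt {A : Subgroup S} {χ : A → K} {w : W} :
    w ∈ wt ρ A χ ↔ ∀ a : A, ρ (a : S) w = χ a • w := by
  simp [wt, Submodule.mem_iInf]

theorem exists_wt [IsAlgClosed K] [FiniteDimensional K W] [Nontrivial W] (A : Subgroup S)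
    (hA : ∀ x ∈ A, ∀ y ∈ A, x * y = y * x) : ∃ χ : A → K, wt ρ A χ ≠ ⊥ := by
  let P : Submodule K W → Prop := fun U => U ≠ ⊥ ∧ ∀ a ∈ A, ∀ u ∈ U, ρ a u ∈ U
  obtain ⟨U, hU⟩ := exists_minimal_of_wellFoundedLT P ⟨⊤, top_ne_bot, fun _ _ _ _ => trivial⟩
  have key : ∀ a : A, ∃ c : K, ∀ u ∈ U, ρ (a : S) u = c • u := by
    intro a
    have : Nontrivial U := Submodule.nontrivial_iff_ne_bot.mpr hU.prop.1
    obtain ⟨c, hc⟩ := Module.End.exists_eigenvalue ((ρ (a : S)).restrict (hU.prop.2 a a.2))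
    obtain ⟨v, hv, hv0⟩ := hc.exists_hasEigenvector
    have hv1 : ρ (a : S) (v : W) = c • (v : W) := by
      rw [Module.End.mem_eigenspace_iff] at hv
      exact congrArg Subtype.val hv
    refine ⟨c, ?_⟩
    let U' := U ⊓ Module.End.eigenspace (ρ (a : S)) c
    have hU' : P U' := by
      constructor
      · intro h
        have : (v : W) ∈ U' := ⟨v.2, Module.End.mem_eigenspace_iff.mpr hv1⟩
        rw [h, Submodule.mem_bot] at this
        exact hv0 (Subtype.ext this)
      · rintro b hb u ⟨hu, hu'⟩
        refine ⟨hU.prop.2 b hb u hu, ?_⟩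
        rw [SetLike.mem_coe, Module.End.mem_eigenspace_iff] at hu' ⊢
        rw [← Module.End.mul_apply, ← map_mul, hA a a.2 b hb, map_mul, Module.End.mul_apply, hu',
          map_smul]
    have := hU.le_of_le hU' inf_le_left
    intro u hu
    exact Module.End.mem_eigenspace_iff.mp (this hu).2
  choose χ hχ using key
  refine ⟨χ, fun h => hU.prop.1 (le_bot_iff.mp (h ▸ fun u hu => ?_))⟩
  exact (mem_wt ρ).mpr fun a => hχ a u hu

/-- stabilizer of a weight -/
def wstab (A : Subgroup S) [hA : A.Normal] (χ : A → K) : Subgroup S where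
  carrier := {g | ∀ a : A, χ ⟨g * a * g⁻¹, hA.conj_mem a a.2 g⟩ = χ a}
  one_mem' := fun a => by simp
  mul_mem' := by
    intro g h hg hh a
    have := hg ⟨h * a * h⁻¹, hA.conj_mem a a.2 h⟩
    rw [hh a] at this
    rw [← this]
    congr 2; group
  inv_mem' := by
    intro g hg a
    have := hg ⟨g⁻¹ * a * g, by simpa using hA.conj_mem a a.2 g⁻¹⟩
    rw [eq_comm]
    convert this using 2
    · apply Subtype.ext; simp [mul_assoc]
    · apply Subtype.ext; simp

theorem wt_map (A : Subgroup S) [hA : A.Normal] (χ : A → K) (g : S) :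
    (wt ρ A χ).map (ρ g) =
      wt ρ A (fun a => χ ⟨g⁻¹ * a * g, by simpa using hA.conj_mem a a.2 g⁻¹⟩) := by
  apply le_antisymm
  · rintro _ ⟨w, hw, rfl⟩
    rw [SetLike.mem_coe, mem_wt] at hw
    rw [mem_wt]
    intro a
    have := hw ⟨g⁻¹ * a * g, by simpa using hA.conj_mem a a.2 g⁻¹⟩
    rw [← map_smul, ← this]
    simp only [← Module.End.mul_apply, ← map_mul]
    congr 2; group
  · intro w hw
    rw [mem_wt] at hw
    refine ⟨ρ g⁻¹ w, ?_, by simp⟩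
    rw [SetLike.mem_coe, mem_wt]
    intro a
    have := hw ⟨g * a * g⁻¹, hA.conj_mem a a.2 g⟩
    have hx : (⟨g⁻¹ * (g * a * g⁻¹) * g, by
        simpa using hA.conj_mem _ (hA.conj_mem a a.2 g) g⁻¹⟩ : A) = a :=
      Subtype.ext (by simp [mul_assoc])
    rw [hx] at this
    rw [← map_smul, ← this]
    simp only [← Module.End.mul_apply, ← map_mul]
    congr 2; group

theorem wstab_pres (A : Subgroup S) [hA : A.Normal] (χ : A → K) (g : S) (hg : g ∈ wstab A χ) :
    wt ρ A χ ≤ (wt ρ A χ).comap (ρ g) := by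
  rw [← Submodule.map_le_iff_le_comap, wt_map]
  apply le_of_eq
  congr 1
  funext a
  have := (wstab A χ).inv_mem hg a
  simpa using this

theorem wt_indep [FiniteDimensional K W] (A : Subgroup S) (hA : ∀ x ∈ A, ∀ y ∈ A, x * y = y * x) :
    iSupIndep fun χ : A → K => wt ρ A χ := by
  have := Module.End.independent_iInf_maxGenEigenspace_of_forall_mapsTo (fun a : A => ρ (a : S)) (by
    intro a b c
    apply Module.End.mapsTo_maxGenEigenspace_of_comm
    change ρ _ * ρ _ = ρ _ * ρ _
    rw [← map_mul, ← map_mul, hA _ a.2 _ b.2])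
  refine this.mono fun χ => ?_
  exact iInf_mono fun a => Module.End.eigenspace_le_maxGenEigenspace

theorem wt_count [FiniteDimensional K W] [Finite S] (A : Subgroup S) [hAn : A.Normal]
    (hA : ∀ x ∈ A, ∀ y ∈ A, x * y = y * x) (χ : A → K) :
    (wstab A χ).index * Module.finrank K (wt ρ A χ) ≤ Module.finrank K W := by
  let c : S ⧸ wstab A χ → (A → K) := fun x =>
    fun a => χ ⟨(x.out)⁻¹ * a * x.out, by simpa using hAn.conj_mem a a.2 (x.out)⁻¹⟩
  have hc : Function.Injective c := by
    intro x y hxy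
    rw [← x.out_eq, ← y.out_eq]
    apply QuotientGroup.eq.mpr
    intro a
    have := congrFun hxy ⟨y.out * a * (y.out)⁻¹, hAn.conj_mem a a.2 _⟩
    simp only [c] at this
    convert this using 2 <;> apply Subtype.ext <;> simp [mul_assoc]
  have hi : iSupIndep fun x => wt ρ A (c x) := (wt_indep ρ A hA).comp hc
  have := sum_finrank_le _ hi (Module.finrank K (wt ρ A χ)) (by
    intro x
    rw [← wt_map]
    refine (LinearEquiv.finrank_eq (Submodule.equivMapOfInjective (ρ x.out) ?_ _)).symm
    exact ρ.apply_bijective _ |>.injective)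
  exact this
end wt
end OddSol

namespace OddSol

section
variable {K : Type} [Field K] {W : Type} [AddCommGroup W] [Module K W]
  {H : Type} [Group H] [Finite H] (ρ : Representation K H W)

/-- irreducibility -/
def Irr : Prop := ∀ U : Submodule K W, (∀ g, U ≤ U.comap (ρ g)) → U = ⊥ ∨ U = ⊤

variable {ρ}

theorem not_uni_on {q : ℕ} [Fact q.Prime] [CharP K q] (hf : Function.Injective ρ) (hirr : Irr ρ)
    {N : Subgroup H} [hN : N.Normal] (hNb : N ≠ ⊥) {U : Submodule K W} (hU : U ≠ ⊥)
    (hUN : ∀ n ∈ N, U ≤ U.comap (ρ n)) :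
    ∃ n ∈ N, ∃ u ∈ U, ∀ k : ℕ, (ρ n ^ (q ^ k)) u ≠ u := by
  by_contra! hc
  have : Nontrivial U := Submodule.nontrivial_iff_ne_bot.mpr hU
  let σ : Representation K N W := ρ.comp N.subtype
  have hσ : ∀ g, U ≤ U.comap (σ g) := fun g => hUN g g.2
  obtain ⟨w, hw0, hw⟩ := fixed_vec (q := q) (σ.subrepresentation U hσ)
    (fun n => (uni_sub_iff σ U hσ n).mpr (hc n n.2))
  let F : Submodule K W :=
    { carrier := {w | ∀ n ∈ N, ρ n w = w}
      add_mem' := fun {a b} ha hb n hn => by rw [map_add, ha n hn, hb n hn]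
      zero_mem' := fun n hn => map_zero _
      smul_mem' := fun c x hx n hn => by rw [map_smul, hx n hn] }
  have hF : ∀ g, F ≤ F.comap (ρ g) := by
    intro g x hx n hn
    have h1 := hx (g⁻¹ * n * g) (by simpa using hN.conj_mem n hn g⁻¹)
    have h2 := congrArg (ρ g) h1
    rw [← Module.End.mul_apply, ← map_mul] at h2
    rw [← Module.End.mul_apply, ← map_mul, ← h2]
    congr 2; group
  have hwF : (w : W) ∈ F := fun n hn => congrArg Subtype.val (hw ⟨n, hn⟩)
  rcases hirr F hF with h | h
  · rw [h, Submodule.mem_bot] at hwF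
    exact hw0 (Subtype.ext hwF)
  · apply hNb
    rw [eq_bot_iff]
    intro n hn
    rw [Subgroup.mem_bot]
    apply hf
    rw [map_one]
    ext x
    have : x ∈ F := h ▸ trivial
    exact this n hn

theorem sub_apply {q : ℕ} [Fact q.Prime] [CharP K q] [IsAlgClosed K] [FiniteDimensional K W]
    [Group.IsSolvable H] (hodd : Odd (Nat.card H))
    (hf : Function.Injective ρ) (hirr : Irr ρ)
    {N : Subgroup H} [hN : N.Normal] (hNb : N ≠ ⊥) {U : Submodule K W} (hU : U ≠ ⊥)
    {B : Subgroup H} (hUB : ∀ n ∈ B, U ≤ U.comap (ρ n)) {k : ℕ}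
    (hNB : N ≤ (derivedSeries B k).map B.subtype) (hL : LinS (Module.finrank K U)) :
    Bd k (Module.finrank K U) := by
  have hNB' : N ≤ B := hNB.trans (Subgroup.map_subtype_le _)
  obtain ⟨n, hn, u, hu, h⟩ := not_uni_on (q := q) hf hirr hNb hU (fun n hn => hUB n (hNB' hn))
  obtain ⟨b, hb, rfl⟩ := hNB hn
  let σ : Representation K B W := ρ.comp B.subtype
  have hσ : ∀ g, U ≤ U.comap (σ g) := fun g => hUB g g.2
  refine hL q K U rfl B (hodd.of_dvd_nat (Subgroup.card_subgroup_dvd_card B))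
    (σ.subrepresentation U hσ) k b hb ?_
  rw [uni_sub_iff]
  push Not
  exact ⟨u, hu, h⟩
end

theorem hom_count {K : Type*} [Field K] {E : Type*} [Group E] [Finite E] (A : Subgroup E)
    [A.Normal] : Finite {f : E →* Kˣ // A ≤ f.ker} ∧ Nat.card {f : E →* Kˣ // A ≤ f.ker} ≤ A.index := by
  have hQ : Finite ((E ⧸ A) →* K) := by
    have := (linearIndependent_monoidHom (E ⧸ A) K).finite
    exact this
  have hc : Nat.card ((E ⧸ A) →* K) ≤ A.index := by
    have := Fintype.ofFinite ((E ⧸ A) →* K)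
    have := Fintype.ofFinite (E ⧸ A)
    have h := (linearIndependent_monoidHom (E ⧸ A) K).fintype_card_le_finrank
    rw [Module.finrank_fintype_fun_eq_card] at h
    rw [Subgroup.index, Nat.card_eq_fintype_card, Nat.card_eq_fintype_card]
    exact h
  let Φ : {f : E →* Kˣ // A ≤ f.ker} → ((E ⧸ A) →* K) := fun f =>
    (Units.coeHom K).comp (QuotientGroup.lift A f.1 f.2)
  have hΦ : Function.Injective Φ := by
    intro f g hfg
    apply Subtype.ext
    ext x
    have := DFunLike.congr_fun hfg (QuotientGroup.mk x)
    simpa [Φ] using this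
  exact ⟨Finite.of_injective Φ hΦ, (Nat.card_le_card_of_injective Φ hΦ).trans hc⟩
end OddSol

namespace OddSol
open scoped commutatorElement
section
variable {H : Type*} [Group H]

theorem comm_mul_right_central {h x y : H} (hy : ⁅h, y⁆ ∈ Subgroup.center H) :
    ⁅h, x * y⁆ = ⁅h, x⁆ * ⁅h, y⁆ := by
  have e : ⁅h, x * y⁆ = ⁅h, x⁆ * (x * ⁅h, y⁆ * x⁻¹) := by simp only [commutatorElement_def]; group
  rw [e, Subgroup.mem_center_iff.mp hy x, mul_inv_cancel_right]

theorem comm_mul_left_central {g h x : H} (hy : ⁅h, x⁆ ∈ Subgroup.center H) :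
    ⁅g * h, x⁆ = ⁅g, x⁆ * ⁅h, x⁆ := by
  have e : ⁅g * h, x⁆ = (g * ⁅h, x⁆ * g⁻¹) * ⁅g, x⁆ := by simp only [commutatorElement_def]; group
  rw [e, Subgroup.mem_center_iff.mp hy g, mul_inv_cancel_right, Subgroup.mem_center_iff.mp hy]

/-- centralizer of `E` modulo the center -/
def modC (E : Subgroup H) : Subgroup H where
  carrier := {h | ∀ x ∈ E, ⁅h, x⁆ ∈ Subgroup.center H}
  one_mem' := fun x _ => by rw [commutatorElement_one_left]; exact one_mem _
  mul_mem' := by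
    intro g h hg hh x hx
    rw [comm_mul_left_central (hh x hx)]
    exact mul_mem (hg x hx) (hh x hx)
  inv_mem' := by
    intro g hg x hx
    have e : ⁅g⁻¹, x⁆ = g⁻¹ * ⁅g, x⁆⁻¹ * g⁻¹⁻¹ := by simp only [commutatorElement_def]; group
    rw [e]
    exact (inferInstance : (Subgroup.center H).Normal).conj_mem _ (inv_mem (hg x hx)) _

theorem mem_modC {E : Subgroup H} {h : H} :
    h ∈ modC E ↔ ∀ x ∈ E, ⁅h, x⁆ ∈ Subgroup.center H := Iff.rfl

variable {K : Type*} [Field K] (θ : Subgroup.center H →* Kˣ) (E : Subgroup H)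

/-- the commutator pairing -/
def Lam : modC E →* (E →* Kˣ) where
  toFun h :=
    { toFun := fun x => θ ⟨⁅(h : H), (x : H)⁆, h.2 x x.2⟩
      map_one' := by
        rw [← map_one θ]; congr 1; apply Subtype.ext; simp
      map_mul' := fun x y => by
        rw [← map_mul]; congr 1; apply Subtype.ext
        simpa using comm_mul_right_central (h.2 y y.2) }
  map_one' := by
    ext x
    simp only [MonoidHom.coe_mk, OneHom.coe_mk, MonoidHom.one_apply]
    rw [← map_one θ]; congr 2; apply Subtype.ext; simp
  map_mul' g h := by
    ext x
    simp only [MonoidHom.coe_mk, OneHom.coe_mk, MonoidHom.mul_apply]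
    rw [← map_mul]; congr 2; apply Subtype.ext
    simpa using comm_mul_left_central (h.2 x x.2)

variable {θ E}

theorem Lam_ker (hθ : Function.Injective θ) (h : modC E) : h ∈ (Lam θ E).ker ↔ ∀ x ∈ E, (h : H) * x = x * h := by
  rw [MonoidHom.mem_ker]
  constructor
  · intro hh x hx
    have h1 := DFunLike.congr_fun hh ⟨x, hx⟩
    have h2 : θ ⟨⁅(h : H), x⁆, h.2 x hx⟩ = θ 1 := by rw [map_one]; exact h1
    have h3 := congrArg Subtype.val (hθ h2)
    exact commutatorElement_eq_one_iff_mul_comm.mp h3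
  · intro hh
    ext x
    have : (Lam θ E h) x = θ ⟨⁅(h : H), (x : H)⁆, h.2 x x.2⟩ := rfl
    rw [this, MonoidHom.one_apply, ← map_one θ]
    congr 2
    exact Subtype.ext (commutatorElement_eq_one_iff_mul_comm.mpr (hh x x.2))

theorem Lam_card [Finite H] (hθ : Function.Injective θ) (hZ : ∀ x ∈ E, (∀ y ∈ E, x * y = y * x) → x ∈ Subgroup.center H)
    {A : Subgroup H} (hAE : A ≤ E) (hAC : A ≤ modC E) :
    Nat.card (((Lam θ E).comp (Subgroup.inclusion hAC)).range) = (Subgroup.center H).relIndex A := by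
  rw [← Subgroup.index_ker, Subgroup.relIndex]
  congr 1
  ext a
  rw [MonoidHom.mem_ker, MonoidHom.comp_apply, ← MonoidHom.mem_ker, Lam_ker hθ,
    Subgroup.mem_subgroupOf]
  constructor
  · intro h; exact hZ a (hAE a.2) h
  · intro h x _; exact (Subgroup.mem_center_iff.mp h x).symm

theorem relIndex_le [Finite H] (hθ : Function.Injective θ) (hE : E ≤ modC E)
    (hZ : ∀ x ∈ E, (∀ y ∈ E, x * y = y * x) → x ∈ Subgroup.center H)
    {A : Subgroup H} (hZA : Subgroup.center H ≤ A) (hAE : A ≤ E)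
    (hA : ∀ x ∈ A, ∀ y ∈ A, x * y = y * x) :
    (Subgroup.center H).relIndex A ≤ A.relIndex E := by
  rw [← Lam_card hθ hZ hAE (hAE.trans hE), Subgroup.relIndex]
  have hn : (A.subgroupOf E).Normal := by
    constructor
    intro a ha g
    rw [Subgroup.mem_subgroupOf] at ha ⊢
    have h1 : ⁅(g : H), (a : H)⁆ * a ∈ A := A.mul_mem (hZA (hE g.2 a a.2)) ha
    simpa [commutatorElement_def] using h1
  obtain ⟨h1, h2⟩ := hom_count (K := K) (A.subgroupOf E)
  refine le_trans ?_ h2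
  refine Nat.card_le_card_of_injective (fun f => ⟨f.1, ?_⟩) ?_
  · rintro x hx
    obtain ⟨_, a, rfl⟩ := f
    rw [Subgroup.mem_subgroupOf] at hx
    have := (Lam_ker hθ (E := A) (θ := θ) ⟨a, fun y hy => hE (hAE a.2) y (hAE hy)⟩).mpr (fun y hy => hA a a.2 y hy)
    rw [MonoidHom.mem_ker] at this ⊢
    exact DFunLike.congr_fun this ⟨x, hx⟩
  · intro f g hfg
    exact Subtype.ext (Subtype.mk.inj hfg)

theorem modC_decomp [Finite H] (hθ : Function.Injective θ) (hE : E ≤ modC E)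
    (hZ : ∀ x ∈ E, (∀ y ∈ E, x * y = y * x) → x ∈ Subgroup.center H)
    (h : H) (hh : h ∈ modC E) :
    ∃ e ∈ E, ∃ b ∈ Subgroup.centralizer (E : Set H), h = e * b := by
  have hc := Lam_card hθ hZ le_rfl hE
  have hn : ((Subgroup.center H).subgroupOf E).Normal := inferInstance
  obtain ⟨h1, h2⟩ := hom_count (K := K) ((Subgroup.center H).subgroupOf E)
  have htriv : ∀ c : modC E, (Subgroup.center H).subgroupOf E ≤ (Lam θ E c).ker := by
    intro c x hx
    rw [Subgroup.mem_subgroupOf] at hx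
    rw [MonoidHom.mem_ker]
    have : (Lam θ E c) x = θ ⟨⁅(c : H), (x : H)⁆, c.2 x x.2⟩ := rfl
    rw [this, ← map_one θ]
    congr 1
    exact Subtype.ext (commutatorElement_eq_one_iff_mul_comm.mpr (Subgroup.mem_center_iff.mp hx c))
  let ι : ((Lam θ E).comp (Subgroup.inclusion hE)).range →
    {f : E →* Kˣ // (Subgroup.center H).subgroupOf E ≤ f.ker} := fun f =>
      ⟨f.1, by obtain ⟨_, a, rfl⟩ := f; exact htriv (Subgroup.inclusion hE a)⟩
  have hι : Function.Injective ι := fun f g hfg => Subtype.ext (Subtype.mk.inj hfg)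
  have hbij : Function.Bijective ι := by
    rw [Nat.bijective_iff_injective_and_card]
    refine ⟨hι, le_antisymm (Nat.card_le_card_of_injective ι hι) ?_⟩
    rw [hc]; exact h2
  obtain ⟨⟨_, e, rfl⟩, he⟩ := hbij.2 ⟨Lam θ E ⟨h, hh⟩, htriv _⟩
  have he' : Lam θ E (Subgroup.inclusion hE e) = Lam θ E ⟨h, hh⟩ := congrArg Subtype.val he
  have hk : (Subgroup.inclusion hE e)⁻¹ * ⟨h, hh⟩ ∈ (Lam θ E).ker := by
    rw [MonoidHom.mem_ker, map_mul, map_inv, he', inv_mul_cancel]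
  rw [Lam_ker hθ] at hk
  refine ⟨e, e.2, (e : H)⁻¹ * h, ?_, by group⟩
  rw [Subgroup.mem_centralizer_iff]
  intro x hx
  exact (hk x hx).symm
end
end OddSol

namespace OddSol
open scoped commutatorElement

/-- the permutation statement in degree `r` -/
def PermS (r : ℕ) : Prop :=
  ∀ (H : Type) [Group H] [Finite H] [Group.IsSolvable H], Odd (Nat.card H) →
    ∀ (X : Type) [Finite X] [MulAction H X], Nat.card X = r →
    ∀ (s : ℕ) (h : H), h ∈ derivedSeries H s → (∃ x : X, h • x ≠ x) → 7 ^ (s + 1) ≤ r ^ 2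

/-- least index of a derived term inside a given subgroup -/
theorem exists_least {H : Type*} [Group H] [hs : Group.IsSolvable H] (T : Subgroup H) :
    ∃ j, derivedSeries H j ≤ T ∧ ∀ i < j, ¬ derivedSeries H i ≤ T := by
  classical
  have hex : ∃ j, derivedSeries H j ≤ T := by
    obtain ⟨n, hn⟩ := hs.solvable
    exact ⟨n, hn ▸ bot_le⟩
  exact ⟨Nat.find hex, Nat.find_spec hex, fun i hi => Nat.find_min hex hi⟩

section
variable {K : Type} [Field K] {W : Type} [AddCommGroup W] [Module K W]
  {H : Type} [Group H] [Finite H] {ρ : Representation K H W}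

theorem lin_case1 {q : ℕ} [Fact q.Prime] [CharP K q] [IsAlgClosed K] [FiniteDimensional K W]
    [Nontrivial W] [Group.IsSolvable H] (hodd : Odd (Nat.card H))
    (hf : Function.Injective ρ) (hirr : Irr ρ) {n : ℕ} (hn : Module.finrank K W = n)
    (hP : ∀ r ≤ n, PermS r) (hL : ∀ m < n, LinS m) {s : ℕ} (hs : derivedSeries H s ≠ ⊥)
    (A : Subgroup H) [A.Normal] (hA : ∀ x ∈ A, ∀ y ∈ A, x * y = y * x)
    (hns : ¬ ∀ a ∈ A, ∃ c : K, ∀ w, ρ a w = c • w) : Bd s n := by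
  obtain ⟨χ, hχ⟩ := exists_wt ρ A hA
  set U := wt ρ A χ with hU
  set T := wstab A χ with hT
  have hcount := wt_count ρ A hA χ
  rw [hn, ← hU, ← hT] at hcount
  have hUt : U ≠ ⊤ := by
    intro h
    apply hns
    intro a ha
    refine ⟨χ ⟨a, ha⟩, fun w => ?_⟩
    have : w ∈ U := h ▸ trivial
    exact (mem_wt ρ).mp this ⟨a, ha⟩
  have hTt : T ≠ ⊤ := by
    intro h
    rcases hirr U (fun g => wstab_pres ρ A χ g (by rw [← hT, h]; trivial)) with h | h
    · exact hχ h
    · exact hUt h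
  set u := Module.finrank K U with hu
  have hu1 : 1 ≤ u := by
    rw [Nat.one_le_iff_ne_zero, hu]
    intro h
    exact hχ (Submodule.finrank_eq_zero.mp h)
  have hun : u < n := hn ▸ Submodule.finrank_lt hUt
  have hr3 : 3 ≤ T.index := by
    have h1 : Odd T.index := hodd.of_dvd_nat (Subgroup.index_dvd_card T)
    have h2 : T.index ≠ 1 := fun h => hTt (Subgroup.index_eq_one.mp h)
    obtain ⟨a, ha⟩ := h1
    omega
  set r := T.index with hr
  have hrn : r ≤ n := (Nat.le_mul_of_pos_right r hu1).trans hcount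
  obtain ⟨j, hj, hjm⟩ := exists_least T.normalCore
  have hj0 : j ≠ 0 := by
    rintro rfl
    rw [derivedSeries_zero, top_le_iff] at hj
    exact hTt (top_le_iff.mp (hj ▸ T.normalCore_le))
  obtain ⟨i, rfl⟩ := Nat.exists_eq_succ_of_ne_zero hj0
  have hji := hjm i (Nat.lt_succ_self i)
  obtain ⟨g, hg, hgT⟩ := SetLike.not_le_iff_exists.mp hji
  have hperm : 7 ^ (i + 1) ≤ r ^ 2 := by
    refine hP r hrn H hodd (H ⧸ T) rfl i g hg ?_
    by_contra! hc
    apply hgT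
    rw [Subgroup.normalCore_eq_ker, MonoidHom.mem_ker]
    ext x
    exact hc x
  have hr2 : r ^ 2 ≤ n ^ 2 := Nat.pow_le_pow_left hrn 2
  rcases Nat.lt_or_ge s (i + 1) with hsi | hsi
  · have h7 : 7 ^ s ≤ 7 ^ (i + 1) := Nat.pow_le_pow_right (by norm_num) hsi.le
    refine ⟨by omega, fun _ => by omega, fun h2 => ?_⟩
    have : 7 ^ 2 ≤ 7 ^ (i + 1) := Nat.pow_le_pow_right (by norm_num) (by omega)
    nlinarith
  · obtain ⟨t, rfl⟩ := Nat.exists_eq_add_of_le hsi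
    have hb : Bd t u := by
      refine sub_apply (q := q) (N := derivedSeries H (i + 1 + t)) (B := derivedSeries H (i + 1)) hodd hf hirr hs hχ
        (fun g hg => wstab_pres ρ A χ g (T.normalCore_le (hj hg))) ?_ (hL _ hun)
      rw [derived_sub]
    refine ⟨?_, fun _ => by omega, fun h2 => ?_⟩
    · calc 7 ^ (i + 1 + t) = 7 ^ (i + 1) * 7 ^ t := pow_add _ _ _
        _ ≤ r ^ 2 * (7 * u ^ 2) := Nat.mul_le_mul hperm hb.1
        _ = 7 * (r * u) ^ 2 := by ring
        _ ≤ 7 * n ^ 2 := by gcongr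
    · rcases Nat.eq_zero_or_pos i with rfl | hi
      · have := hb.2.1 (by omega)
        nlinarith
      · have : 7 ^ 2 ≤ 7 ^ (i + 1) := Nat.pow_le_pow_right (by norm_num) (by omega)
        nlinarith
end
end OddSol

namespace OddSol
open scoped commutatorElement

section
variable {H : Type} [Group H]

/-- maximal abelian subgroup of `E` containing `Z` -/
theorem exists_max_abelian [Finite H] (E Z : Subgroup H) (hZE : Z ≤ E)
    (hZ : ∀ x ∈ Z, ∀ y ∈ Z, x * y = y * x) :
    ∃ A : Subgroup H, Z ≤ A ∧ A ≤ E ∧ (∀ x ∈ A, ∀ y ∈ A, x * y = y * x) ∧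
      ∀ x ∈ E, (∀ a ∈ A, a * x = x * a) → x ∈ A := by
  obtain ⟨A, hA⟩ := (Set.toFinite {A : Subgroup H | Z ≤ A ∧ A ≤ E ∧
    ∀ x ∈ A, ∀ y ∈ A, x * y = y * x}).exists_maximal ⟨Z, le_rfl, hZE, hZ⟩
  refine ⟨A, hA.prop.1, hA.prop.2.1, hA.prop.2.2, fun x hx hxA => ?_⟩
  have hle : A ≤ A ⊔ Subgroup.zpowers x := le_sup_left
  have h := hA.le_of_ge (y := A ⊔ Subgroup.zpowers x) ⟨hA.prop.1.trans hle,
    sup_le hA.prop.2.1 (by rwa [Subgroup.zpowers_le]), ?_⟩ hle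
  · exact h (Subgroup.mem_sup_right (Subgroup.mem_zpowers x))
  · have h1 : A ⊔ Subgroup.zpowers x ≤ Subgroup.centralizer (A : Set H) := by
      refine sup_le (fun y hy => ?_) ?_
      · exact Subgroup.mem_centralizer_iff.mpr fun a ha => hA.prop.2.2 a ha y hy
      · rw [Subgroup.zpowers_le]
        exact Subgroup.mem_centralizer_iff.mpr hxA
    have h2 : A ⊔ Subgroup.zpowers x ≤
        Subgroup.centralizer ((A ⊔ Subgroup.zpowers x : Subgroup H) : Set H) := by
      refine sup_le (Subgroup.le_centralizer_iff.mp h1) ?_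
      rw [Subgroup.zpowers_le, Subgroup.mem_centralizer_iff]
      intro y hy
      have h3 : A ⊔ Subgroup.zpowers x ≤ Subgroup.centralizer {x} := by
        refine sup_le (fun a ha => ?_) ?_
        · exact Subgroup.mem_centralizer_iff.mpr (by rintro _ rfl; exact (hxA a ha).symm)
        · rw [Subgroup.zpowers_le]
          exact Subgroup.mem_centralizer_iff.mpr (by rintro _ rfl; rfl)
      exact (Subgroup.mem_centralizer_iff.mp (h3 hy) x rfl).symm
    intro a ha b hb
    exact Subgroup.mem_centralizer_iff.mp (h2 hb) a ha

theorem derived_le_B {E B : Subgroup H} {j : ℕ}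
    (hE : ∀ x ∈ E, ∀ y ∈ E, ⁅x, y⁆ ∈ Subgroup.center H)
    (hB : B = Subgroup.centralizer (E : Set H))
    (hdec : ∀ h ∈ derivedSeries H j, ∃ e ∈ E, ∃ b ∈ B, h = e * b) (t : ℕ) :
    derivedSeries H (j + 2 + t) ≤ (derivedSeries B (2 + t)).map B.subtype := by
  induction t with
  | zero =>
    have hBB : (derivedSeries B 1).map B.subtype = ⁅B, B⁆ := by
      rw [derivedSeries_succ, derivedSeries_zero, Subgroup.map_commutator,
        ← MonoidHom.range_eq_map, Subgroup.range_subtype]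
    have h1 : derivedSeries H (j + 1) ≤ Subgroup.center H ⊔ ⁅B, B⁆ := by
      rw [derivedSeries_succ, Subgroup.commutator_le]
      intro x hx y hy
      obtain ⟨e, he, b, hb, rfl⟩ := hdec x hx
      obtain ⟨e', he', b', hb', rfl⟩ := hdec y hy
      have c1 : e' * b = b * e' := Subgroup.mem_centralizer_iff.mp (hB ▸ hb) e' he'
      have c2 : e * b' = b' * e := Subgroup.mem_centralizer_iff.mp (hB ▸ hb') e he
      have c3 : e * b = b * e := Subgroup.mem_centralizer_iff.mp (hB ▸ hb) e he
      have c4 : e' * b' = b' * e' := Subgroup.mem_centralizer_iff.mp (hB ▸ hb') e' he'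
      have : ⁅e * b, e' * b'⁆ = ⁅e, e'⁆ * ⁅b, b'⁆ := by
        have d1 : ∀ z, b * (e' * z) = e' * (b * z) := fun z => by
          rw [← mul_assoc, ← c1, mul_assoc]
        have hc : ∀ f ∈ E, ∀ a ∈ B, Commute f a := fun f hf a ha =>
          Subgroup.mem_centralizer_iff.mp (hB ▸ ha) f hf
        rw [commutatorElement_def, commutatorElement_def, commutatorElement_def, mul_inv_rev, mul_inv_rev]
        have k1 : Commute e'⁻¹ b'⁻¹ := hc _ (inv_mem he') _ (inv_mem hb')
        have k2 : Commute e⁻¹ b⁻¹ := hc _ (inv_mem he) _ (inv_mem hb)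
        have k3 : Commute e' b := hc _ he' _ hb
        have k4 : Commute e⁻¹ (b * b') := hc _ (inv_mem he) _ (mul_mem hb hb')
        have k5 : Commute e'⁻¹ (b * b' * b⁻¹) :=
          hc _ (inv_mem he') _ (mul_mem (mul_mem hb hb') (inv_mem hb))
        calc e * b * (e' * b') * (b⁻¹ * e⁻¹) * (b'⁻¹ * e'⁻¹)
            = e * (b * e') * b' * (b⁻¹ * e⁻¹) * (b'⁻¹ * e'⁻¹) := by group
          _ = e * (e' * b) * b' * (e⁻¹ * b⁻¹) * (e'⁻¹ * b'⁻¹) := by rw [k1.eq, k2.eq, k3.eq]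
          _ = e * e' * ((b * b') * e⁻¹) * b⁻¹ * e'⁻¹ * b'⁻¹ := by group
          _ = e * e' * e⁻¹ * ((b * b' * b⁻¹) * e'⁻¹) * b'⁻¹ := by rw [← k4.eq]; group
          _ = _ := by rw [← k5.eq]; group
      rw [this]
      exact Subgroup.mul_mem_sup (hE e he e' he') (Subgroup.commutator_mem_commutator hb hb')
    have h2 : (derivedSeries B (2 + 0)).map B.subtype = ⁅⁅B, B⁆, ⁅B, B⁆⁆ := by
      rw [add_zero, derivedSeries_succ, Subgroup.map_commutator, hBB]
    rw [h2, add_zero, derivedSeries_succ, Subgroup.commutator_le]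
    intro x hx y hy
    obtain ⟨z, hz, b, hb, rfl⟩ := Subgroup.mem_sup_of_normal_left.mp (h1 hx)
    obtain ⟨z', hz', b', hb', rfl⟩ := Subgroup.mem_sup_of_normal_left.mp (h1 hy)
    have : ⁅z * b, z' * b'⁆ = ⁅b, b'⁆ := by
      have e1 : ⁅z * b, z' * b'⁆ = z * ⁅b, z' * b'⁆ * z⁻¹ * ⁅z, z' * b'⁆ := by
        simp only [commutatorElement_def]; group
      have e2 : ⁅z, z' * b'⁆ = 1 := commutatorElement_eq_one_iff_mul_comm.mpr
        (Subgroup.mem_center_iff.mp hz _).symm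
      have e3 : ⁅b, z' * b'⁆ = ⁅b, z'⁆ * (z' * ⁅b, b'⁆ * z'⁻¹) := by
        simp only [commutatorElement_def]; group
      have e4 : ⁅b, z'⁆ = 1 := commutatorElement_eq_one_iff_mul_comm.mpr
        (Subgroup.mem_center_iff.mp hz' _)
      rw [e1, e2, e3, e4, one_mul, mul_one, ← Subgroup.mem_center_iff.mp hz',
        mul_inv_cancel_right, ← Subgroup.mem_center_iff.mp hz, mul_inv_cancel_right]
    rw [this]
    exact Subgroup.commutator_mem_commutator hb hb'
  | succ t ih =>
    rw [← add_assoc, ← add_assoc, derivedSeries_succ, derivedSeries_succ, Subgroup.map_commutator]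
    exact Subgroup.commutator_mono ih ih
end
end OddSol

namespace OddSol
open scoped commutatorElement

section
variable {K : Type} [Field K] {W : Type} [AddCommGroup W] [Module K W]
  {H : Type} [Group H] [Finite H] {ρ : Representation K H W}

theorem scalar_central (hf : Function.Injective ρ) {a : H} {c : K} (h : ∀ w, ρ a w = c • w) :
    a ∈ Subgroup.center H := by
  rw [Subgroup.mem_center_iff]
  intro g
  apply hf
  ext w
  rw [map_mul, map_mul, Module.End.mul_apply, Module.End.mul_apply, h, h, map_smul]

theorem exists_theta [Nontrivial W] (hf : Function.Injective ρ)
    (hsc : ∀ z ∈ Subgroup.center H, ∃ c : K, ∀ w, ρ z w = c • w) :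
    ∃ θ : Subgroup.center H →* Kˣ, Function.Injective θ ∧ ∀ (z : Subgroup.center H) (w : W), ρ (z : H) w = (θ z : K) • w := by
  obtain ⟨w0, hw0⟩ := exists_ne (0 : W)
  choose f hf' using fun z : Subgroup.center H => hsc z z.2
  let θ0 : Subgroup.center H →* K :=
    { toFun := f
      map_one' := by
        have := hf' 1 w0
        rw [OneMemClass.coe_one, map_one, Module.End.one_apply] at this
        exact (smul_left_injective K hw0 (by simpa using this)).symm
      map_mul' := fun a b => by
        have := hf' (a * b) w0
        rw [Subgroup.coe_mul, map_mul, Module.End.mul_apply, hf', hf', smul_smul] at this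
        exact (smul_left_injective K hw0 this).symm }
  refine ⟨θ0.toHomUnits, ?_, fun z w => hf' z w⟩
  intro a b hab
  have hab' : f a = f b := congrArg Units.val hab
  apply Subtype.ext
  apply hf
  ext w
  rw [hf', hf', hab']

theorem lin_case2 {q : ℕ} [Fact q.Prime] [CharP K q] [IsAlgClosed K] [FiniteDimensional K W]
    [Nontrivial W] [Group.IsSolvable H] (hodd : Odd (Nat.card H))
    (hf : Function.Injective ρ) (hirr : Irr ρ) {n : ℕ} (hn : Module.finrank K W = n)
    (hL : ∀ m < n, LinS m) {s : ℕ} (hs1 : 1 ≤ s) (hs : derivedSeries H s ≠ ⊥)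
    (hsc : ∀ A : Subgroup H, A.Normal → (∀ x ∈ A, ∀ y ∈ A, x * y = y * x) →
      ∀ a ∈ A, ∃ c : K, ∀ w, ρ a w = c • w) : Bd s n := by
  set Z := Subgroup.center H with hZ
  have hZc : ∀ z ∈ Z, ∀ g : H, z * g = g * z := fun z hz g => (Subgroup.mem_center_iff.mp hz g).symm
  have habZ : ∀ A : Subgroup H, A.Normal → (∀ x ∈ A, ∀ y ∈ A, x * y = y * x) → A ≤ Z := by
    intro A hA hA' a ha
    obtain ⟨c, hc⟩ := hsc A hA hA' a ha
    exact scalar_central hf hc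
  obtain ⟨θ, hθ, hθρ⟩ := exists_theta hf (hsc Z inferInstance (fun x hx y _ => hZc x hx y))
  have hZt : Z ≠ ⊤ := by
    intro h
    apply hs
    rw [eq_bot_iff]
    refine (derivedSeries_antitone H hs1).trans ?_
    rw [derivedSeries_succ, derivedSeries_zero, ← h]
    rw [Subgroup.commutator_le]
    intro x hx y hy
    rw [Subgroup.mem_bot, commutatorElement_eq_one_iff_mul_comm]
    exact hZc x hx y
  have hntq : Nontrivial (H ⧸ Z) := QuotientGroup.nontrivial_iff.mpr hZt
  obtain ⟨V, hV, -⟩ := exists_minNormal (⊤ : Subgroup (H ⧸ Z)) inferInstance top_ne_bot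
  have hqs : Group.IsSolvable (H ⧸ Z) := inferInstance
  obtain ⟨p, l, hp, hel, hcard, hl0⟩ := hV.elem
  have hVn := hV.normal
  set E := V.comap (QuotientGroup.mk' Z) with hEdef
  have hEn : E.Normal := inferInstance
  have hZE : Z ≤ E := by
    intro z hz
    rw [hEdef, Subgroup.mem_comap]
    have : QuotientGroup.mk' Z z = 1 := (QuotientGroup.eq_one_iff z).mpr hz
    rw [this]; exact one_mem _
  have hEV : E.map (QuotientGroup.mk' Z) = V :=
    Subgroup.map_comap_eq_self_of_surjective (QuotientGroup.mk'_surjective Z) V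
  have hcomm : ∀ x y : H, ⁅x, y⁆ ∈ Z ↔
      QuotientGroup.mk' Z x * QuotientGroup.mk' Z y = QuotientGroup.mk' Z y * QuotientGroup.mk' Z x := by
    intro x y
    rw [← commutatorElement_eq_one_iff_mul_comm, ← map_commutatorElement]
    exact (QuotientGroup.eq_one_iff _).symm
  have hE : E ≤ modC E := by
    intro x hx y hy
    exact (hcomm x y).mpr (hV.comm _ hx _ hy)
  have hEZ : ¬ E ≤ Z := by
    intro h
    apply hV.ne_bot
    rw [← hEV, eq_bot_iff]
    rintro _ ⟨x, hx, rfl⟩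
    rw [Subgroup.mem_bot]
    exact (QuotientGroup.eq_one_iff x).mpr (h hx)
  have hZE' : ∀ x ∈ E, (∀ y ∈ E, x * y = y * x) → x ∈ Z := by
    intro x hx hxy
    refine habZ (E ⊓ Subgroup.centralizer (E : Set H)) inferInstance ?_ ⟨hx, ?_⟩
    · rintro a ⟨ha, _⟩ b ⟨_, hb⟩
      exact Subgroup.mem_centralizer_iff.mp hb a ha
    · exact Subgroup.mem_centralizer_iff.mpr fun y hy => (hxy y hy).symm
  have hrel : Z.relIndex E = p ^ l := by
    rw [← hcard, ← hEV]
    rw [← Subgroup.relIndex_ker, QuotientGroup.ker_mk']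
  obtain ⟨A, hZA, hAE, hAab, hAmax⟩ := exists_max_abelian E Z hZE (fun x hx y _ => hZc x hx y)
  have hle := relIndex_le hθ hE hZE' hZA hAE hAab
  have hmul := Subgroup.relIndex_mul_relIndex Z A E hZA hAE
  set r := A.relIndex E with hr
  rw [hrel] at hmul
  obtain ⟨k, hkl, hk⟩ := (Nat.dvd_prime_pow hp).mp (Dvd.intro_left _ hmul)
  have hpl : p ^ l ≤ (p ^ k) ^ 2 := by
    rw [← hmul, ← hk]; nlinarith
  have hl2 : l ≤ 2 * k := by
    rw [← pow_mul, mul_comm] at hpl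
    exact (Nat.pow_le_pow_iff_right hp.one_lt).mp hpl
  have hk1 : 1 ≤ k := by omega
  obtain ⟨j, hj, hjm⟩ := exists_least (modC E)
  have hj0 : j ≠ 0 := by
    rintro rfl
    rw [derivedSeries_zero, top_le_iff] at hj
    have hAn : A.Normal := by
      constructor
      intro a ha g
      have h1 : ⁅g, a⁆ * a ∈ A := A.mul_mem (hZA ((hj ▸ trivial : g ∈ modC E) a (hAE ha))) ha
      simpa [commutatorElement_def] using h1
    have hAZ := habZ A hAn hAab
    apply hEZ
    intro x hx
    exact hAZ (hAmax x hx (fun a ha => hZc a (hAZ ha) x))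
  obtain ⟨i, rfl⟩ := Nat.exists_eq_succ_of_ne_zero hj0
  obtain ⟨g, hg, hgE⟩ := SetLike.not_le_iff_exists.mp (hjm i (Nat.lt_succ_self i))
  rw [mem_modC] at hgE
  push Not at hgE
  obtain ⟨x, hx, hgx⟩ := hgE
  have hoddq : Odd (Nat.card (H ⧸ Z)) := hodd.of_dvd_nat (Subgroup.card_quotient_dvd_card Z)
  obtain ⟨hbd, h7, h9, hp3⟩ := chief hoddq hV hp hel hcard i
    ⟨QuotientGroup.mk' Z g, by
      rw [← map_derivedSeries_eq (QuotientGroup.mk'_surjective Z)]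
      exact Subgroup.mem_map_of_mem _ hg, QuotientGroup.mk' Z x, hx, fun h => hgx ((hcomm g x).mpr h)⟩
  have hr5 : 5 ≤ p ^ k := by
    by_contra! hlt
    have h1 : p ^ 1 ≤ p ^ k := Nat.pow_le_pow_right hp.pos hk1
    rw [pow_one] at h1
    have hp4 : p ≤ 4 := by omega
    have hpe : p = 3 := by
      interval_cases p
      · rfl
      · norm_num at hp
    subst hpe
    have hk' : k = 1 := by
      by_contra hne
      have : 3 ^ 2 ≤ 3 ^ k := Nat.pow_le_pow_right (by norm_num) (by omega)
      omega
    subst hk'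
    have : l = 1 ∨ l = 2 := by omega
    rcases this with rfl | rfl
    · norm_num at h7
    · norm_num at h9
  -- weight spaces for `A` in `E`
  let σ : Representation K E W := ρ.comp E.subtype
  have hA'n : (A.subgroupOf E).Normal := by
    constructor
    intro a ha g
    rw [Subgroup.mem_subgroupOf] at ha ⊢
    have h1 : ⁅(g : H), (a : H)⁆ * a ∈ A := A.mul_mem (hZA (hE g.2 a a.2)) ha
    simpa [commutatorElement_def] using h1
  have hA'c : ∀ x ∈ A.subgroupOf E, ∀ y ∈ A.subgroupOf E, x * y = y * x := by
    intro x hx y hy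
    exact Subtype.ext (hAab x hx y hy)
  obtain ⟨χ, hχ⟩ := exists_wt σ (A.subgroupOf E) hA'c
  have hcount := wt_count σ (A.subgroupOf E) hA'c χ
  set U := wt σ (A.subgroupOf E) χ with hU
  rw [hn] at hcount
  obtain ⟨w0, hw0U, hw00⟩ := Submodule.exists_mem_ne_zero_of_ne_bot hχ
  have hw0 := (mem_wt σ).mp hw0U
  have hstab : wstab (A.subgroupOf E) χ ≤ A.subgroupOf E := by
    intro g hg
    rw [Subgroup.mem_subgroupOf]
    apply hAmax g g.2
    intro a ha
    have h1 := hg ⟨⟨a, hAE ha⟩, ha⟩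
    have hz : ⁅(g : H), a⁆ ∈ Z := hE g.2 a (hAE ha)
    have h2 := hw0 ⟨g * ⟨a, hAE ha⟩ * g⁻¹, hA'n.conj_mem _ ha g⟩
    rw [h1, ← hw0] at h2
    have h3 : ρ ((g : H) * a * (g : H)⁻¹) w0 = ρ a w0 := h2
    have e : (g : H) * a * (g : H)⁻¹ = ⁅(g : H), a⁆ * a := by simp [commutatorElement_def]
    rw [e, map_mul, Module.End.mul_apply, hθρ ⟨⁅(g : H), a⁆, hz⟩] at h3
    have hne : ρ a w0 ≠ 0 := by
      intro h0
      apply hw00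
      have := congrArg (ρ a⁻¹) h0
      rwa [← Module.End.mul_apply, ← map_mul, inv_mul_cancel, map_one, map_zero] at this
    have h4 : (θ ⟨_, hz⟩ : K) = 1 := smul_left_injective K hne (by simpa using h3)
    have h5 : (⟨_, hz⟩ : Z) = 1 := hθ (by rw [map_one]; exact Units.ext h4)
    have h6 : ⁅(g : H), a⁆ = 1 := congrArg Subtype.val h5
    exact (commutatorElement_eq_one_iff_mul_comm.mp h6).symm
  have hri : r ≤ (wstab (A.subgroupOf E) χ).index :=
    Nat.le_of_dvd (Nat.pos_of_ne_zero Subgroup.index_ne_zero_of_finite) (Subgroup.index_dvd_of_le hstab)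
  set u := Module.finrank K U with hu
  have hu1 : 1 ≤ u := by
    rw [Nat.one_le_iff_ne_zero, hu]
    intro h
    exact hχ (Submodule.finrank_eq_zero.mp h)
  have hru : r * u ≤ n := (Nat.mul_le_mul_right u hri).trans hcount
  rw [hk] at hru
  have hrn : p ^ k ≤ n := (Nat.le_mul_of_pos_right _ hu1).trans hru
  have hun : u < n := by nlinarith
  have hr2 : (p ^ k) ^ 2 ≤ n ^ 2 := Nat.pow_le_pow_left hrn 2
  have hln : l < n := by
    have h1 : 3 ^ l ≤ p ^ l := Nat.pow_le_pow_left hp3 l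
    have h2 := sq_lt_three_pow n
    exact (Nat.pow_lt_pow_iff_right (a := 3) (by norm_num)).mp (by omega)
  have hbl := hbd (hL l hln)
  have h7j := num_lin hp3 hk1 hl2 hbl
  refine ⟨?_, fun _ => by omega, fun _ => by omega⟩
  rcases Nat.lt_or_ge s (i + 1 + 2) with hsi | hsi
  · have : 7 ^ s ≤ 7 ^ (i + 1 + 1) := Nat.pow_le_pow_right (by norm_num) (by omega)
    rw [pow_succ 7 (i + 1)] at this
    omega
  · obtain ⟨t, rfl⟩ := Nat.exists_eq_add_of_le hsi
    have hb : Bd (2 + t) u := by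
      refine sub_apply (q := q) (N := derivedSeries H (i + 1 + 2 + t))
        (B := Subgroup.centralizer (E : Set H)) hodd hf hirr hs hχ ?_ ?_ (hL _ hun)
      · intro b hb w hw
        rw [Submodule.mem_comap]
        rw [hU, mem_wt] at hw ⊢
        intro a
        have := hw a
        have h1 : (a : H) * b = b * a := Subgroup.mem_centralizer_iff.mp hb a a.1.2
        change ρ (a : H) (ρ b w) = χ a • ρ b w
        rw [← Module.End.mul_apply, ← map_mul, h1, map_mul, Module.End.mul_apply]
        change ρ b (σ a w) = _
        rw [this, map_smul]
      · exact derived_le_B (fun x hx y hy => hE hx y hy) rfl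
          (fun h hh => modC_decomp hθ hE hZE' h (hj hh)) t
    calc 7 ^ (i + 1 + 2 + t) = 7 ^ (i + 1) * 7 ^ (2 + t) := by rw [add_assoc, pow_add]
      _ ≤ (p ^ k) ^ 2 * (7 * u ^ 2) := Nat.mul_le_mul h7j hb.1
      _ = 7 * (p ^ k * u) ^ 2 := by ring
      _ ≤ 7 * n ^ 2 := by gcongr
end
end OddSol

namespace OddSol
open scoped commutatorElement

theorem quot_solv {H : Type*} [Group H] [Group.IsSolvable H] (N : Subgroup H) [N.Normal] :
    Group.IsSolvable (H ⧸ N) := inferInstance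

theorem odd_quot {H : Type*} [Group H] (N : Subgroup H) (h : Odd (Nat.card H)) :
    Odd (Nat.card (H ⧸ N)) := by
  rw [Subgroup.card_eq_card_quotient_mul_card_subgroup N] at h
  exact Nat.Odd.of_mul_left h

theorem odd_sub {H : Type*} [Group H] (N : Subgroup H) (h : Odd (Nat.card H)) :
    Odd (Nat.card N) := by
  rw [Subgroup.card_eq_card_quotient_mul_card_subgroup N] at h
  exact Nat.Odd.of_mul_right h

theorem mk_derived {H : Type*} [Group H] (N : Subgroup H) [N.Normal] (s : ℕ) :
    (derivedSeries H s).map (QuotientGroup.mk' N) = derivedSeries (H ⧸ N) s :=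
  map_derivedSeries_eq (QuotientGroup.mk'_surjective N) s

theorem linS_step (n : ℕ) (hP : ∀ r ≤ n, PermS r) (hL : ∀ m < n, LinS m) : LinS n := by
  intro q _ K _ _ _ W _ _ _ hn H _ _ _ hodd ρ s h hs hu
  by_cases hirr : Irr ρ
  · have hnt : Nontrivial W := by
      by_contra hc
      rw [not_nontrivial_iff_subsingleton] at hc
      exact hu (fun w => ⟨0, Subsingleton.elim _ _⟩)
    have hn1 : 1 ≤ n := by rw [← hn]; exact Module.finrank_pos
    rcases Nat.eq_zero_or_pos s with rfl | hs1
    · refine ⟨?_, by omega, by omega⟩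
      nlinarith
    set N : Subgroup H := MonoidHom.ker ρ with hN
    let ρ' : Representation K (H ⧸ N) W := QuotientGroup.lift N ρ (fun x hx => hx)
    have hρ' : ∀ g : H, ρ' (g : H ⧸ N) = ρ g := fun g => rfl
    have hf : Function.Injective ρ' := by
      intro a b
      induction a using QuotientGroup.induction_on with | H a => ?_
      induction b using QuotientGroup.induction_on with | H b => ?_
      intro hab
      rw [hρ', hρ'] at hab
      rw [QuotientGroup.eq, hN, MonoidHom.mem_ker, map_mul, ← hab, ← map_mul, inv_mul_cancel, map_one]
    have hirr' : Irr ρ' := fun U hU => hirr U (fun g => hU (g : H ⧸ N))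
    have hne : derivedSeries (H ⧸ N) s ≠ ⊥ := by
      intro hb
      have : (h : H ⧸ N) ∈ derivedSeries (H ⧸ N) s := by
        rw [← mk_derived]; exact ⟨h, hs, rfl⟩
      rw [hb, Subgroup.mem_bot, QuotientGroup.eq_one_iff, hN, MonoidHom.mem_ker] at this
      exact hu (fun w => ⟨0, by simp [this]⟩)
    have hodd' := odd_quot N hodd
    by_cases hsc : ∀ A : Subgroup (H ⧸ N), A.Normal → (∀ x ∈ A, ∀ y ∈ A, x * y = y * x) →
      ∀ a ∈ A, ∃ c : K, ∀ w, ρ' a w = c • w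
    · exact lin_case2 (q := q) hodd' hf hirr' hn hL hs1 hne hsc
    · push Not at hsc
      obtain ⟨A, hA, hab, a, ha, hc⟩ := hsc
      refine lin_case1 (q := q) hodd' hf hirr' hn hP hL hne A hab ?_
      intro h'
      obtain ⟨c, hc'⟩ := h' a ha
      obtain ⟨w, hw⟩ := hc c
      exact hw (hc' w)
  · unfold Irr at hirr
    push Not at hirr
    obtain ⟨U, hU, hb, ht⟩ := hirr
    have hlt : Module.finrank K U < n := hn ▸ Submodule.finrank_lt ht
    have hq := Submodule.finrank_quotient_add_finrank U
    have hpos : 0 < Module.finrank K U := by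
      rw [Module.finrank_pos_iff, Submodule.nontrivial_iff_ne_bot]; exact hb
    by_cases h1 : Uni q (ρ.subrepresentation U hU h)
    · by_cases h2 : Uni q (ρ.quotient U hU h)
      · exact absurd (uni_ext ρ U hU h h1 h2) hu
      · exact (hL (Module.finrank K (W ⧸ U)) (by omega) q K (W ⧸ U) rfl H hodd
          (ρ.quotient U hU) s h hs h2).mono (by omega)
    · exact (hL _ hlt q K U rfl H hodd (ρ.subrepresentation U hU) s h hs h1).mono hlt.le

end OddSol

namespace OddSol
open scoped commutatorElement

theorem moves_coset {H : Type*} [Group H] (S : Subgroup H) {h : H} (hh : h ∉ S) :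
    ∃ x : H ⧸ S, h • x ≠ x := by
  refine ⟨((1 : H) : H ⧸ S), fun he => hh ?_⟩
  have h2 : ((h * 1 : H) : H ⧸ S) = ((1 : H) : H ⧸ S) := he
  rw [mul_one] at h2
  have := QuotientGroup.eq.mp h2.symm
  simpa using this

theorem perm_core {H : Type} [Group H] [Finite H] [Group.IsSolvable H] (hodd : Odd (Nat.card H))
    (S : Subgroup H) (hcore : ∀ N : Subgroup H, N.Normal → N ≤ S → N = ⊥) {r : ℕ}
    (hr : S.index = r) (hP : ∀ r' < r, PermS r') (hL : ∀ m < r, LinS m) {s : ℕ}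
    (hs : derivedSeries H s ≠ ⊥) : 7 ^ (s + 1) ≤ r ^ 2 := by
  have htop : (⊤ : Subgroup H) ≠ ⊥ := by
    intro h
    apply hs
    exact le_bot_iff.mp (h ▸ le_top)
  obtain ⟨M, hM, -⟩ := exists_minNormal (⊤ : Subgroup H) inferInstance htop
  have hMn := hM.normal
  have hMS : ¬ M ≤ S := fun h => hM.ne_bot (hcore M hMn h)
  have hsS : ¬ derivedSeries H s ≤ S := fun h => hs (hcore _ inferInstance h)
  have hrpos : 0 < r := hr ▸ Nat.pos_of_ne_zero Subgroup.index_ne_zero_of_finite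
  by_cases hT : M ⊔ S = ⊤
  · -- regular normal subgroup
    have hdecomp : ∀ g : H, ∃ m ∈ M, ∃ t ∈ S, m * t = g := by
      intro g
      have : g ∈ M ⊔ S := hT ▸ Subgroup.mem_top g
      rwa [Subgroup.mem_sup_of_normal_left] at this
    have hnormal : ∀ C : Subgroup H, C.Normal → (∀ c ∈ C, ∀ m ∈ M, c * m = m * c) → C ⊓ S = ⊥ := by
      intro C hC hCM
      refine hcore _ ⟨?_⟩ inf_le_right
      rintro c ⟨hc, hcS⟩ g
      obtain ⟨m, hm, t, ht, rfl⟩ := hdecomp g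
      have h1 : t * c * t⁻¹ ∈ C := hC.conj_mem c hc t
      have h2 : m * t * c * (m * t)⁻¹ = t * c * t⁻¹ := by
        have := hCM _ h1 m hm
        calc m * t * c * (m * t)⁻¹ = m * (t * c * t⁻¹) * m⁻¹ := by group
          _ = t * c * t⁻¹ := by rw [← this]; group
      rw [h2]
      exact ⟨h1, S.mul_mem (S.mul_mem ht hcS) (S.inv_mem ht)⟩
    have hMc := hM.comm
    have hMSb : M ⊓ S = ⊥ := hnormal M hMn hMc
    have hcard : Nat.card M = r := by
      have hcompl : Subgroup.IsComplement' M S := by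
        apply Subgroup.isComplement'_of_disjoint_and_mul_eq_univ (disjoint_iff.mpr hMSb)
        rw [Set.eq_univ_iff_forall]
        intro g
        obtain ⟨m, hm, t, ht, rfl⟩ := hdecomp g
        exact Set.mul_mem_mul hm ht
      rw [← hr, hcompl.index_eq_card]
    obtain ⟨q, k, hqp, hel, hqk, hk0⟩ := hM.elem
    rcases Nat.eq_zero_or_pos s with rfl | hs1
    · have hrodd : Odd r := hcard ▸ odd_sub M hodd
      have hr1 : r ≠ 1 := by
        intro h
        rw [← hcard] at h
        exact hM.ne_bot (Subgroup.card_eq_one.mp h)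
      have : 3 ≤ r := by
        obtain ⟨u, hu⟩ := hrodd
        omega
      norm_num
      nlinarith
    · obtain ⟨i, rfl⟩ : ∃ i, s = i + 1 := ⟨s - 1, by omega⟩
      have hnc : ∃ g ∈ derivedSeries H i, ∃ v ∈ M, g * v ≠ v * g := by
        by_contra hcon
        push Not at hcon
        have hle : derivedSeries H i ≤ M := by
          -- use the full centralizer
          have hCn : (Subgroup.centralizer (M : Set H)).Normal := inferInstance
          have hCb := hnormal (Subgroup.centralizer (M : Set H)) hCn
            (fun c hc m hm => (Subgroup.mem_centralizer_iff.mp hc m hm).symm)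
          intro g hg
          obtain ⟨m, hm, t, ht, rfl⟩ := hdecomp g
          have htC : t ∈ Subgroup.centralizer (M : Set H) := by
            have h1 : m * t ∈ Subgroup.centralizer (M : Set H) := by
              rw [Subgroup.mem_centralizer_iff]
              intro v hv
              exact (hcon _ hg v hv).symm
            have h2 : m ∈ Subgroup.centralizer (M : Set H) := by
              rw [Subgroup.mem_centralizer_iff]
              intro v hv
              exact hMc v hv m hm
            simpa using Subgroup.mul_mem _ (Subgroup.inv_mem _ h2) h1
          have : t ∈ (⊥ : Subgroup H) := hCb ▸ ⟨htC, ht⟩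
          rw [Subgroup.mem_bot] at this
          rw [this, mul_one]
          exact hm
        apply hs
        rw [derivedSeries_succ, Subgroup.commutator_eq_bot_iff_le_centralizer]
        intro x hx
        rw [Subgroup.mem_centralizer_iff]
        intro y hy
        exact hMc y (hle hy) x (hle hx)
      obtain ⟨h1, h2, -, h4⟩ := chief hodd hM hqp hel hqk i hnc
      rw [← hcard, hqk]
      refine num_perm h4 h2 (h1 (hL k ?_))
      rw [← hcard, hqk]
      exact Nat.lt_pow_self hqp.one_lt
  · set T := M ⊔ S with hTdef
    obtain ⟨j, hj, hjmin⟩ := exists_least T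
    have hST : S ≤ T := le_sup_right
    have hmul := Subgroup.relIndex_mul_index hST
    rw [hr] at hmul
    have hT1 : T.index ≠ 1 := fun h => hT (Subgroup.index_eq_one.mp h)
    have hS1 : S.relIndex T ≠ 1 := by
      intro h
      rw [Subgroup.relIndex_eq_one] at h
      exact hMS (le_sup_left.trans h)
    have hTpos : 0 < T.index := Nat.pos_of_ne_zero Subgroup.index_ne_zero_of_finite
    have hSpos : 0 < S.relIndex T := Nat.pos_of_ne_zero (by intro h; rw [h] at hmul; omega)
    have hTr : T.index < r := by
      rw [← hmul]
      have : 2 ≤ S.relIndex T := by omega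
      nlinarith
    have hSr : S.relIndex T < r := by
      rw [← hmul]
      have : 2 ≤ T.index := by omega
      nlinarith
    have hj0 : j ≠ 0 := by
      rintro rfl
      rw [derivedSeries_zero, top_le_iff] at hj
      exact hT hj
    have h1 : 7 ^ j ≤ T.index ^ 2 := by
      have := hjmin (j - 1) (by omega)
      rw [SetLike.not_le_iff_exists] at this
      obtain ⟨h, hh, hhT⟩ := this
      have := hP T.index hTr H hodd (H ⧸ T) rfl (j - 1) h hh (moves_coset T hhT)
      rwa [Nat.sub_add_cancel (by omega)] at this
    rcases Nat.lt_or_ge s j with hsj | hsj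
    · calc 7 ^ (s + 1) ≤ 7 ^ j := Nat.pow_le_pow_right (by norm_num) hsj
        _ ≤ T.index ^ 2 := h1
        _ ≤ r ^ 2 := Nat.pow_le_pow_left hTr.le 2
    · set K := derivedSeries H j with hK
      have h2 : S.relIndex K ≤ S.relIndex T :=
        Subgroup.relIndex_le_of_le_right hj (by omega)
      rw [SetLike.not_le_iff_exists] at hsS
      obtain ⟨h, hh, hhS⟩ := hsS
      have hsub := derived_sub (G := H) j (s - j)
      rw [Nat.add_sub_cancel' hsj] at hsub
      rw [← hsub] at hh
      obtain ⟨k, hk, rfl⟩ := hh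
      have h3 := hP (S.relIndex K) (h2.trans_lt hSr) K (odd_sub K hodd) (K ⧸ S.subgroupOf K) rfl
        (s - j) k hk (moves_coset _ (by rw [Subgroup.mem_subgroupOf]; exact hhS))
      calc 7 ^ (s + 1) = 7 ^ (s - j + 1) * 7 ^ j := by rw [← pow_add]; congr 1; omega
        _ ≤ (S.relIndex K) ^ 2 * T.index ^ 2 := Nat.mul_le_mul h3 h1
        _ ≤ (S.relIndex T) ^ 2 * T.index ^ 2 := by gcongr
        _ = r ^ 2 := by rw [← mul_pow, hmul]

theorem permS_step (r : ℕ) (hP : ∀ r' < r, PermS r') (hL : ∀ m < r, LinS m) : PermS r := by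
  intro H _ _ _ hodd X _ _ hX s h hs hx
  obtain ⟨x, hx⟩ := hx
  set S := MulAction.stabilizer H x with hS
  set N := S.normalCore with hN
  have hNS : N ≤ S := Subgroup.normalCore_le S
  have hhS : h ∉ S := by rw [hS, MulAction.mem_stabilizer_iff]; exact hx
  have hle : S.index ≤ r := by
    rw [hS, MulAction.index_stabilizer, ← hX]
    exact Set.ncard_le_card _
  have hidx : (S.map (QuotientGroup.mk' N)).index = S.index := by
    apply Subgroup.index_map_eq _ (QuotientGroup.mk'_surjective N)
    rw [QuotientGroup.ker_mk']
    exact hNS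
  have hcore : ∀ U : Subgroup (H ⧸ N), U.Normal → U ≤ S.map (QuotientGroup.mk' N) → U = ⊥ := by
    intro U hU hUS
    have h1 : U.comap (QuotientGroup.mk' N) ≤ S := by
      intro g hg
      obtain ⟨t, ht, htg⟩ := hUS hg
      have : t⁻¹ * g ∈ N := QuotientGroup.eq.mp htg
      have h2 := S.mul_mem ht (hNS this)
      simpa using h2
    have h2 : U.comap (QuotientGroup.mk' N) ≤ N := Subgroup.normal_le_normalCore.mpr h1
    rw [eq_bot_iff]
    intro u hu
    obtain ⟨g, rfl⟩ := QuotientGroup.mk'_surjective N u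
    rw [Subgroup.mem_bot]
    exact (QuotientGroup.eq_one_iff g).mpr (h2 hu)
  have hne : derivedSeries (H ⧸ N) s ≠ ⊥ := by
    intro hb
    have : (h : H ⧸ N) ∈ derivedSeries (H ⧸ N) s := by
      rw [← mk_derived]; exact ⟨h, hs, rfl⟩
    rw [hb, Subgroup.mem_bot, QuotientGroup.eq_one_iff] at this
    exact hhS (hNS this)
  have := perm_core (odd_quot N hodd) (S.map (QuotientGroup.mk' N)) hcore hidx
    (fun r' hr' => hP r' (by omega)) (fun m hm => hL m (by omega)) hne
  exact this.trans (Nat.pow_le_pow_left hle 2)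

theorem all_S (n : ℕ) : PermS n ∧ LinS n := by
  induction n using Nat.strong_induction_on with
  | _ n ih =>
    have hp := permS_step n (fun r hr => (ih r hr).1) (fun m hm => (ih m hm).2)
    refine ⟨hp, linS_step n (fun r hr => ?_) (fun m hm => (ih m hm).2)⟩
    rcases hr.lt_or_eq with h | rfl
    · exact (ih r h).1
    · exact hp

end OddSol

namespace OddSol
open scoped commutatorElement

section
variable {G : Type} [Group G]

theorem three_sub {A B C P : Subgroup G} [P.Normal] (h1 : ⁅⁅B, C⁆, A⁆ ≤ P) (h2 : ⁅⁅C, A⁆, B⁆ ≤ P) :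
    ⁅⁅A, B⁆, C⁆ ≤ P := by
  have key : ∀ X : Subgroup G, X ≤ P ↔ X.map (QuotientGroup.mk' P) = ⊥ := by
    intro X
    rw [Subgroup.map_eq_bot_iff, QuotientGroup.ker_mk']
  rw [key, Subgroup.map_commutator, Subgroup.map_commutator] at *
  exact Subgroup.commutator_commutator_eq_bot_of_rotate h1 h2

theorem lcs_normal (N : Subgroup G) [hN : N.Normal] (k : ℕ) : (N.lowerCentralSeries k).Normal := by
  induction k with
  | zero => exact hN
  | succ k ih => rw [Subgroup.lowerCentralSeries_succ]; infer_instance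

theorem lcs_comm (N : Subgroup G) [N.Normal] (j : ℕ) : ∀ i,
    ⁅N.lowerCentralSeries i, N.lowerCentralSeries j⁆ ≤ N.lowerCentralSeries (i + j + 1) := by
  induction j with
  | zero => intro i; exact le_rfl
  | succ j ih =>
    intro i
    have := lcs_normal N (i + (j + 1) + 1)
    rw [Subgroup.commutator_comm, Subgroup.lowerCentralSeries_succ N j]
    apply three_sub
    · rw [Subgroup.commutator_comm N, ← Subgroup.lowerCentralSeries_succ N i]
      have := ih (i + 1)
      rwa [show i + 1 + j + 1 = i + (j + 1) + 1 by ring] at this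
    · have h2 := Subgroup.commutator_mono (ih i) (le_refl N)
      rw [← Subgroup.lowerCentralSeries_succ] at h2
      exact h2

theorem derived_le_lcs (a j : ℕ) :
    derivedSeries G (a + j) ≤ (derivedSeries G a).lowerCentralSeries (2 ^ j - 1) := by
  induction j with
  | zero => exact le_rfl
  | succ j ih =>
    rw [← add_assoc, derivedSeries_succ]
    refine (Subgroup.commutator_mono ih ih).trans ((lcs_comm _ _ _).trans (le_of_eq ?_))
    congr 1
    have := Nat.one_le_two_pow (n := j)
    rw [pow_succ]
    omega

/-- number of prime factors of the order of a subgroup -/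
noncomputable def om (S : Subgroup G) : ℕ := ArithmeticFunction.cardFactors (Nat.card S)

theorem om_add [Finite G] {S T : Subgroup G} (h : S ≤ T) :
    om T = om S + ArithmeticFunction.cardFactors (S.relIndex T) := by
  unfold om
  have h1 := Subgroup.relIndex_mul_relIndex ⊥ S T bot_le h
  rw [Subgroup.relIndex_bot_left, Subgroup.relIndex_bot_left] at h1
  rw [← h1, ArithmeticFunction.cardFactors_mul Nat.card_pos.ne']
  intro h0
  rw [h0, mul_zero] at h1
  exact Nat.card_pos.ne h1

theorem om_lt [Finite G] {S T : Subgroup G} (h : S < T) : om S + 1 ≤ om T := by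
  rw [om_add h.le]
  have h1 : S.relIndex T ≠ 1 := by
    intro h1
    rw [Subgroup.relIndex_eq_one] at h1
    exact absurd h (not_lt_of_ge h1)
  have h0 : S.relIndex T ≠ 0 := by
    have h1 := Subgroup.relIndex_mul_relIndex ⊥ S T bot_le h.le
    rw [Subgroup.relIndex_bot_left, Subgroup.relIndex_bot_left] at h1
    intro h0
    rw [h0, mul_zero] at h1
    exact Nat.card_pos.ne h1
  have : ArithmeticFunction.cardFactors (S.relIndex T) ≠ 0 := by
    rw [Ne, ArithmeticFunction.cardFactors_eq_zero_iff_eq_zero_or_one]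
    omega
  omega

theorem om_chain [Finite G] (L : ℕ → Subgroup G) (m : ℕ) (h : ∀ i < m, L (i + 1) < L i) (i t : ℕ)
    (hit : i + t ≤ m) : om (L (i + t)) + t ≤ om (L i) := by
  induction t with
  | zero => simp
  | succ t ih =>
    have h1 := ih (by omega)
    have h2 := om_lt (h (i + t) (by omega))
    change om (L (i + t + 1)) + (t + 1) ≤ om (L i)
    omega

/-- nilpotent normal subgroup whose lower central series is strict up to the class -/
theorem nil_class [Finite G] (N : Subgroup G) [N.Normal] (hnil : Group.IsNilpotent N)
    : ∃ m, N.lowerCentralSeries m = ⊥ ∧ (∀ i < m, N.lowerCentralSeries i ≠ ⊥) ∧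
      ∀ i < m, N.lowerCentralSeries (i + 1) < N.lowerCentralSeries i := by
  classical
  have hex := (Subgroup.isNilpotent_iff_lowerCentralSeries N).mp hnil
  refine ⟨Nat.find hex, Nat.find_spec hex, fun i hi => Nat.find_min hex hi, ?_⟩
  intro i hi
  refine lt_of_le_of_ne (N.lowerCentralSeries_antitone (Nat.le_succ i)) ?_
  intro he
  have hconst : ∀ t, N.lowerCentralSeries (i + t) = N.lowerCentralSeries i := by
    intro t
    induction t with
    | zero => rfl
    | succ t ih =>
      rw [← add_assoc, Subgroup.lowerCentralSeries_succ, ih, ← Subgroup.lowerCentralSeries_succ, he]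
  apply Nat.find_min hex hi
  rw [← hconst (Nat.find hex - i), Nat.add_sub_cancel' hi.le]
  exact Nat.find_spec hex

theorem minNormal_quot {A A2 : Subgroup G} [hA : A.Normal] [A2.Normal] (hlt : A2 < A)
    (hmax : ∀ P : Subgroup G, P.Normal → A2 ≤ P → P < A → P = A2) :
    MinNormal (A.map (QuotientGroup.mk' A2)) := by
  refine ⟨hA.map _ (QuotientGroup.mk'_surjective A2), ?_, ?_⟩
  · intro h
    rw [Subgroup.map_eq_bot_iff, QuotientGroup.ker_mk'] at h
    exact absurd hlt (not_lt_of_ge h)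
  · intro U hU hUA
    set P := U.comap (QuotientGroup.mk' A2) with hP
    have hUP : U = P.map (QuotientGroup.mk' A2) :=
      (Subgroup.map_comap_eq_self_of_surjective (QuotientGroup.mk'_surjective A2) U).symm
    have h1 : A2 ≤ P := by
      intro x hx
      rw [hP, Subgroup.mem_comap]
      have : QuotientGroup.mk' A2 x = 1 := (QuotientGroup.eq_one_iff x).mpr hx
      rw [this]
      exact U.one_mem
    have h2 : P ≤ A := by
      intro g hg
      obtain ⟨t, ht, htg⟩ := hUA hg
      have : t⁻¹ * g ∈ A2 := QuotientGroup.eq.mp htg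
      have h2 := A.mul_mem ht (hlt.le this)
      simpa using h2
    rcases h2.lt_or_eq with h3 | h3
    · left
      have := hmax P inferInstance h1 h3
      rw [hUP, this, Subgroup.map_eq_bot_iff, QuotientGroup.ker_mk']
    · right
      rw [hUP, h3]

theorem group_bound [Finite G] [hsol : Group.IsSolvable G] (hodd : Odd (Nat.card G)) {d : ℕ} (hd : 1 ≤ d)
    (h0 : derivedSeries G d = ⊥) (h1 : ∀ k < d, derivedSeries G k ≠ ⊥) :
    2 ^ (d - 1) ≤ om (⊤ : Subgroup G) ∨ ∃ a b l, d = a + b + 2 ∧ 1 ≤ l ∧ 7 ^ a ≤ 7 * l ^ 2 ∧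
      l + 2 ^ b ≤ om (⊤ : Subgroup G) := by
  classical
  have hex : ∃ a, Group.IsNilpotent (derivedSeries G a) := by
    refine ⟨d, ?_⟩
    rw [h0]
    infer_instance
  have hlast : Group.IsNilpotent (derivedSeries G (d - 1)) := by
    apply Subgroup.isNilpotent_of_lowerCentralSeries_eq_bot (n := 1)
    rw [Subgroup.lowerCentralSeries_succ, Subgroup.lowerCentralSeries_zero, ← derivedSeries_succ,
      Nat.sub_add_cancel hd, h0]
  obtain ⟨a, hnil, hmin⟩ : ∃ a, Group.IsNilpotent (derivedSeries G a) ∧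
      ∀ i < a, ¬ Group.IsNilpotent (derivedSeries G i) :=
    ⟨Nat.find hex, Nat.find_spec hex, fun i hi => Nat.find_min hex hi⟩
  have had : a ≤ d - 1 := by
    by_contra hc
    exact hmin _ (by omega) hlast
  set N := derivedSeries G a with hN
  obtain ⟨b, hb⟩ : ∃ b, d = a + b + 1 := ⟨d - 1 - a, by omega⟩
  obtain ⟨m, hm0, hmne, hms⟩ := nil_class N hnil
  have hbm : 2 ^ b ≤ m := by
    by_contra hc
    have hle := derived_le_lcs (G := G) a b
    have h2 : N.lowerCentralSeries (2 ^ b - 1) ≤ N.lowerCentralSeries m :=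
      N.lowerCentralSeries_antitone (by omega)
    rw [hm0] at h2
    exact h1 (a + b) (by omega) (le_bot_iff.mp (hle.trans h2))
  rcases Nat.eq_zero_or_pos a with rfl | ha
  · left
    have := om_chain N.lowerCentralSeries m hms 0 m (by omega)
    rw [Subgroup.lowerCentralSeries_zero, hN, derivedSeries_zero] at this
    have e : d - 1 = b := by omega
    rw [e]
    omega
  right
  have hNtop : N < ⊤ := by
    rw [lt_top_iff_ne_top]
    intro h
    apply hmin 0 ha
    rw [derivedSeries_zero, ← h]
    exact hnil
  obtain ⟨a, rfl⟩ : ∃ a', a = a' + 1 := ⟨a - 1, by omega⟩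
  set D := derivedSeries G a with hD
  have hND : N = ⁅D, D⁆ := by rw [hN, derivedSeries_succ]
  -- the minimal normal subgroup `A`
  obtain ⟨A, hA⟩ := (Set.toFinite {P : Subgroup G | P.Normal ∧ P ≤ N ∧
      ∃ t, D.lowerCentralSeries t ≤ P}).exists_minimal
    ⟨N, by rw [hN]; infer_instance, le_rfl, 1, by
      rw [Subgroup.lowerCentralSeries_succ, Subgroup.lowerCentralSeries_zero, hND]⟩
  obtain ⟨hAn, hAN, t, ht⟩ := hA.prop
  have hAne : A ≠ ⊥ := by
    intro h
    rw [h, le_bot_iff] at ht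
    exact hmin a (by omega) (Subgroup.isNilpotent_of_lowerCentralSeries_eq_bot ht)
  obtain ⟨k, hkm, hAk, hAk1⟩ : ∃ k < m, A ≤ N.lowerCentralSeries k ∧
      ¬ A ≤ N.lowerCentralSeries (k + 1) := by
    have hex2 : ∃ k, ¬ A ≤ N.lowerCentralSeries k := ⟨m, by
      rw [hm0, le_bot_iff]; exact hAne⟩
    have hspec := Nat.find_spec hex2
    have hfm : Nat.find hex2 ≤ m := Nat.find_min' hex2 (by
      rw [hm0, le_bot_iff]; exact hAne)
    have hpos : Nat.find hex2 ≠ 0 := by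
      intro h
      rw [h] at hspec
      exact hspec hAN
    refine ⟨Nat.find hex2 - 1, by omega, ?_, ?_⟩
    · have := Nat.find_min hex2 (m := Nat.find hex2 - 1) (by omega)
      exact not_not.mp this
    · rw [Nat.sub_add_cancel (by omega)]
      exact hspec
  set L := N.lowerCentralSeries with hL
  have hLn : (L (k + 1)).Normal := lcs_normal N (k + 1)
  obtain ⟨A2, hA2⟩ := (Set.toFinite {P : Subgroup G | P.Normal ∧ A ⊓ L (k + 1) ≤ P ∧ P < A}).exists_maximal
    ⟨A ⊓ L (k + 1), inferInstance, le_rfl, lt_of_le_of_ne inf_le_left (fun h => hAk1 (inf_eq_left.mp h))⟩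
  obtain ⟨hA2n, hA2i, hA2lt⟩ := hA2.prop
  have hMN := minNormal_quot hA2lt (fun P hP h2 h3 =>
    le_antisymm (hA2.2 ⟨hP, hA2i.trans h2, h3⟩ h2) h2)
  obtain ⟨q, l, hqp, hel, hcard, hl0⟩ := hMN.elem
  have hnc : ∃ g ∈ derivedSeries (G ⧸ A2) a, ∃ v ∈ A.map (QuotientGroup.mk' A2), g * v ≠ v * g := by
    by_contra hcon
    push Not at hcon
    have hDA : ⁅A, D⁆ ≤ A2 := by
      rw [Subgroup.commutator_le]
      intro v hv g hg
      have h3 := hcon (QuotientGroup.mk' A2 g) (by rw [← mk_derived]; exact ⟨g, hg, rfl⟩)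
        (QuotientGroup.mk' A2 v) ⟨v, hv, rfl⟩
      have h4 : QuotientGroup.mk' A2 ⁅v, g⁆ = 1 := by
        rw [map_commutatorElement, commutatorElement_eq_one_iff_mul_comm]
        exact h3.symm
      exact (QuotientGroup.eq_one_iff _).mp h4
    have h5 : D.lowerCentralSeries (t + 1) ≤ A2 := by
      rw [Subgroup.lowerCentralSeries_succ]
      exact (Subgroup.commutator_mono ht le_rfl).trans hDA
    have h6 := hA.2 ⟨hA2n, hA2lt.le.trans hAN, t + 1, h5⟩ hA2lt.le
    exact absurd hA2lt (not_lt_of_ge h6)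
  have hB := (chief (odd_quot A2 hodd) hMN hqp hel hcard a hnc).1 (all_S l).2
  refine ⟨a, b, l, by omega, by omega, hB.1, ?_⟩
  -- counting
  have hrel : A2.relIndex A = q ^ l := by
    rw [← hcard, ← Subgroup.relIndex_ker, QuotientGroup.ker_mk']
  have hdvd : q ^ l ∣ (L (k + 1)).relIndex (L k) := by
    have e1 := Subgroup.relIndex_mul_relIndex (A ⊓ L (k + 1)) A2 A hA2i hA2lt.le
    rw [hrel, Subgroup.inf_relIndex_left] at e1
    have e2 := Subgroup.relIndex_mul_relIndex (L (k + 1)) (A ⊔ L (k + 1)) (L k) le_sup_right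
      (sup_le hAk (N.lowerCentralSeries_antitone (Nat.le_succ k)))
    rw [Subgroup.relIndex_sup_right] at e2
    rw [← e2, ← e1]
    exact ((dvd_refl _).mul_left _).mul_right _
  have hlk : om (L (k + 1)) + l ≤ om (L k) := by
    rw [om_add (hms k hkm).le]
    obtain ⟨u, hu⟩ := hdvd
    have hu0 : u ≠ 0 := by
      rintro rfl
      have e3 := Subgroup.relIndex_mul_relIndex ⊥ (L (k + 1)) (L k) bot_le (hms k hkm).le
      rw [hu, Subgroup.relIndex_bot_left, Subgroup.relIndex_bot_left, mul_zero, mul_zero] at e3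
      exact Nat.card_pos.ne e3
    rw [hu, ArithmeticFunction.cardFactors_mul (pow_ne_zero _ hqp.ne_zero) hu0,
      ArithmeticFunction.cardFactors_apply_prime_pow hqp]
    omega
  have c1 := om_chain L m hms 0 k (by omega)
  have c2 := om_chain L m hms (k + 1) (m - (k + 1)) (by omega)
  rw [zero_add] at c1
  have c3 := om_lt hNtop
  have c4 : om (L 0) = om N := rfl
  omega

end
end OddSol

namespace OddSol

theorem logb72 : (7 / 20 : ℝ) ≤ Real.logb 7 2 := by
  have h : Real.logb 7 ((7 : ℝ) ^ 7) ≤ Real.logb 7 ((2 : ℝ) ^ 20) :=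
    Real.logb_le_logb_of_le (by norm_num) (by norm_num) (by norm_num)
  rw [Real.logb_pow, Real.logb_pow, Real.logb_self_eq_one (by norm_num)] at h
  push_cast at h
  linarith

theorem real_bound1 {d n : ℕ} (hd : 1 ≤ d) (h : 2 ^ (d - 1) ≤ n) :
    (d : ℝ) < (2 * Real.logb 7 2 + 1) * Real.logb 2 n + 2 := by
  obtain ⟨e, rfl⟩ : ∃ e, d = e + 1 := ⟨d - 1, by omega⟩
  rw [Nat.add_sub_cancel] at h
  have h1 : Real.logb 2 ((2 : ℝ) ^ e) ≤ Real.logb 2 n :=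
    Real.logb_le_logb_of_le (by norm_num) (by positivity) (by exact_mod_cast h)
  rw [Real.logb_pow, Real.logb_self_eq_one (by norm_num), mul_one] at h1
  have h2 := logb72
  have h3 : (0 : ℝ) ≤ e := by positivity
  push_cast
  nlinarith

theorem real_bound2 {a b l n : ℕ} (hl : 1 ≤ l) (h7 : 7 ^ a ≤ 7 * l ^ 2) (hn : l + 2 ^ b ≤ n) :
    ((a + b + 2 : ℕ) : ℝ) < (2 * Real.logb 7 2 + 1) * Real.logb 2 n + 2 := by
  have hl0 : (0 : ℝ) < l := by exact_mod_cast hl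
  have hb0 : (0 : ℝ) < (2 : ℝ) ^ b := by positivity
  have hn' : (l : ℝ) + 2 ^ b ≤ n := by exact_mod_cast hn
  have hn0 : (0 : ℝ) < n := by linarith
  have hmul : Real.logb 7 2 * Real.logb 2 n = Real.logb 7 n := by
    rw [Real.mul_logb] <;> norm_num
  have ha : (a : ℝ) ≤ 1 + 2 * Real.logb 7 l := by
    have h : Real.logb 7 ((7 : ℝ) ^ a) ≤ Real.logb 7 (7 * (l : ℝ) ^ 2) :=
      Real.logb_le_logb_of_le (by norm_num) (by positivity) (by exact_mod_cast h7)
    rw [Real.logb_pow, Real.logb_mul (by norm_num) (by positivity), Real.logb_pow,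
      Real.logb_self_eq_one (by norm_num)] at h
    push_cast at h
    linarith
  have hb : ∀ y : ℝ, (2 : ℝ) ^ b ≤ y → (b : ℝ) ≤ Real.logb 2 y := by
    intro y hy
    have h := Real.logb_le_logb_of_le (b := 2) (by norm_num) hb0 hy
    rwa [Real.logb_pow, Real.logb_self_eq_one (by norm_num), mul_one] at h
  have hbn : (b : ℝ) < Real.logb 2 n := by
    have h := Real.logb_lt_logb (b := 2) (by norm_num) hb0 (show (2 : ℝ) ^ b < n by linarith)
    rwa [Real.logb_pow, Real.logb_self_eq_one (by norm_num), mul_one] at h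
  have hln : Real.logb 7 l < Real.logb 7 n :=
    Real.logb_lt_logb (by norm_num) hl0 (by linarith)
  push_cast
  suffices h : (a : ℝ) + b < 2 * Real.logb 7 n + Real.logb 2 n by
    rw [← hmul] at h
    linarith
  by_cases c1 : (2 : ℝ) ^ b ≤ n / 2
  · have := hb _ c1
    rw [Real.logb_div hn0.ne' (by norm_num), Real.logb_self_eq_one (by norm_num)] at this
    linarith
  by_cases c2 : 7 * (l : ℝ) ^ 2 ≤ n ^ 2
  · have h : Real.logb 7 (7 * (l : ℝ) ^ 2) ≤ Real.logb 7 ((n : ℝ) ^ 2) :=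
      Real.logb_le_logb_of_le (by norm_num) (by positivity) c2
    rw [Real.logb_pow, Real.logb_mul (by norm_num) (by positivity), Real.logb_pow,
      Real.logb_self_eq_one (by norm_num)] at h
    push_cast at h
    linarith
  push Not at c1 c2
  have hl2 : (l : ℝ) ≤ n / 2 := by linarith
  have h3 := Real.logb_le_logb_of_le (b := 7) (by norm_num) hl0 hl2
  rw [Real.logb_div hn0.ne' (by norm_num)] at h3
  have h4 : (2 : ℝ) ^ b ≤ 7 / 10 * n := by
    have : (3 / 10 : ℝ) * n ≤ l := by
      by_contra hc
      push Not at hc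
      nlinarith
    linarith
  have h5 : 2 * (b : ℝ) ≤ 2 * Real.logb 2 n - 1 := by
    have h6 : ((2 : ℝ) ^ b) ^ 2 ≤ n ^ 2 / 2 := by nlinarith
    have h7 := Real.logb_le_logb_of_le (b := 2) (by norm_num) (by positivity) h6
    rw [Real.logb_div (by positivity) (by norm_num), Real.logb_pow, Real.logb_pow, Real.logb_pow,
      Real.logb_self_eq_one (by norm_num)] at h7
    push_cast at h7
    linarith
  have := logb72
  linarith

end OddSol

namespace OddSol
open scoped commutatorElement
open Polynomial

/-- a truncated polynomial ring `k[x]/(x^N)`, described abstractly -/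
structure TR (k : Type) [Field k] (R : Type) [CommRing R] [Algebra k R] (x : R) (N : ℕ) : Prop where
  gen : ∀ r : R, ∃ f : k[X], aeval x f = r
  nil : x ^ N = 0
  ne : x ^ (N - 1) ≠ 0
  lift : ∀ y : R, y ^ N = 0 → ∃ φ : R →ₐ[k] R, φ x = y

theorem TR_adjoin (k : Type) [Field k] (N : ℕ) (hN : 1 ≤ N) :
    TR k (AdjoinRoot (X ^ N : k[X])) (AdjoinRoot.root (X ^ N : k[X])) N where
  gen r := by
    obtain ⟨f, rfl⟩ := AdjoinRoot.mk_surjective r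
    exact ⟨f, AdjoinRoot.aeval_eq f⟩
  nil := by
    rw [← AdjoinRoot.mk_X, ← map_pow, AdjoinRoot.mk_self]
  ne := by
    rw [← AdjoinRoot.mk_X, ← map_pow, Ne, AdjoinRoot.mk_eq_zero, pow_dvd_pow_iff X_ne_zero not_isUnit_X]
    omega
  lift y hy := by
    refine ⟨AdjoinRoot.liftAlgHom _ (Algebra.ofId k _) y ?_, ?_⟩
    · simp [hy]
    · simp

section
variable {k : Type} [Field k] {R : Type} [CommRing R] [Algebra k R] {x : R} {N : ℕ}

theorem TR.sub_dvd (h : TR k R x N) (φ : R →ₐ[k] R) (r : R) : φ x - x ∣ φ r - r := by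
  obtain ⟨f, rfl⟩ := h.gen r
  rw [← aeval_algHom_apply, aeval_def, aeval_def, eval₂_eq_eval_map, eval₂_eq_eval_map]
  exact sub_dvd_eval_sub _ _ _

theorem TR.filt (h : TR k R x N) (φ : R →ₐ[k] R) {m i : ℕ} (hm : x ^ (m + 1) ∣ φ x - x) {r : R}
    (hr : x ^ i ∣ r) : x ^ (m + i) ∣ φ r - r := by
  obtain ⟨s, rfl⟩ := hr
  have h1 : x ^ (m + 1) ∣ φ s - s := hm.trans (h.sub_dvd φ s)
  obtain ⟨c, hc⟩ := hm
  have hx : φ x = x * (1 + x ^ m * c) := by linear_combination hc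
  have h2 : x ^ m ∣ (1 + x ^ m * c) ^ i - 1 := by
    have := sub_dvd_pow_sub_pow (1 + x ^ m * c) 1 i
    rw [one_pow, add_sub_cancel_left] at this
    exact (dvd_mul_right _ _).trans this
  obtain ⟨e, he⟩ := h2
  obtain ⟨g, hg⟩ := h1
  refine ⟨e * s + (1 + x ^ m * c) ^ i * x * g, ?_⟩
  rw [map_mul, map_pow, hx, mul_pow]
  linear_combination (x ^ i * s) * he + x ^ i * (1 + x ^ m * c) ^ i * hg

/-- `φ x = x + a x^{m+1} + O(x^{m+2})` -/
def PP (x : R) (φ : R → R) (m : ℕ) (a : k) : Prop :=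
  x ^ (m + 2) ∣ φ x - x - algebraMap k R a * x ^ (m + 1)

theorem PP.weak {φ : R → R} {m : ℕ} {a : k} (h : PP x φ m a) : x ^ (m + 1) ∣ φ x - x := by
  obtain ⟨c, hc⟩ := h
  exact ⟨algebraMap k R a + x * c, by linear_combination hc⟩

theorem PP.pow {φ : R →ₐ[k] R} {m : ℕ} {a : k} (h : PP x φ (m + 1) a) (i : ℕ) :
    x ^ (m + 1 + i + 1) ∣ φ (x ^ i) - x ^ i - i * algebraMap k R a * x ^ (m + 1 + i) := by
  obtain ⟨v, hv⟩ := h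
  set b := algebraMap k R a
  have hx : φ x = x + b * x ^ (m + 2) + x ^ (m + 3) * v := by linear_combination hv
  induction i with
  | zero => simp
  | succ i ih =>
    obtain ⟨u, hu⟩ := ih
    have hxi : φ (x ^ i) = x ^ i + i * b * x ^ (m + 1 + i) + x ^ (m + 1 + i + 1) * u := by
      linear_combination hu
    refine ⟨v + i * b ^ 2 * x ^ m + i * b * v * x ^ (m + 1) +
      u * (1 + b * x ^ (m + 1) + x ^ (m + 2) * v), ?_⟩
    rw [pow_succ x i, map_mul, hxi, hx]
    push_cast
    ring

theorem TR.half (h : TR k R x N) {φ : R →ₐ[k] R} {m l : ℕ} {a b : k} (h1 : PP x φ (m + 1) a)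
    {u : R} (hu : x ^ (l + 2) ∣ u - algebraMap k R b * x ^ (l + 1)) :
    x ^ (m + 1 + l + 2) ∣ φ u - u - ((l + 1 : ℕ) : R) * algebraMap k R (a * b) * x ^ (m + 1 + l + 1) := by
  have e1 := h.filt φ h1.weak hu
  obtain ⟨c, hc⟩ := e1
  obtain ⟨e, he⟩ := h1.pow (l + 1)
  refine ⟨c + algebraMap k R b * e, ?_⟩
  rw [map_sub, map_mul, AlgHom.commutes] at hc
  rw [map_mul]
  linear_combination hc + algebraMap k R b * he

theorem TR.comm (h : TR k R x N) {φ ψ : R →ₐ[k] R} {m l : ℕ} {a b : k} (h1 : PP x φ (m + 1) a)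
    (h2 : PP x ψ (l + 1) b) :
    x ^ (m + l + 4) ∣ φ (ψ x) - ψ (φ x) - algebraMap k R (a * b * ((l : k) - m)) * x ^ (m + l + 3) := by
  obtain ⟨c, hc⟩ := h.half h1 h2
  obtain ⟨e, he⟩ := h.half h2 h1
  refine ⟨c - e, ?_⟩
  simp only [map_sub, map_mul, map_natCast] at hc he ⊢
  push_cast at hc he ⊢
  linear_combination hc - he

end
end OddSol

namespace OddSol
open scoped commutatorElement
open Polynomial

section
variable {k : Type} [Field k] {R : Type} [CommRing R] [Algebra k R] {x : R} {N : ℕ}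

theorem TR.pres (h : TR k R x N) {φ : R →ₐ[k] R} (hm : x ^ 2 ∣ φ x - x) {i : ℕ} {r : R}
    (hr : x ^ i ∣ r) : x ^ i ∣ φ r := by
  have h1 := h.filt φ (m := 1) hm hr
  have h2 : x ^ i ∣ φ r - r := (pow_dvd_pow x (by omega)).trans h1
  simpa using dvd_add h2 hr

/-- the truncated Nottingham group -/
def Nott (h : TR k R x N) [Finite R] : Subgroup (R ≃ₐ[k] R) where
  carrier := {σ | x ^ 2 ∣ σ x - x}
  one_mem' := by simp
  mul_mem' := by
    intro σ τ hσ hτ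
    have h1 : x ^ 2 ∣ σ (τ x - x) := h.pres (φ := (σ : R →ₐ[k] R)) hσ hτ
    have h2 := dvd_add h1 hσ
    rw [map_sub] at h2
    simpa using h2
  inv_mem' := by
    intro σ hσ
    have : Finite (R ≃ₐ[k] R) := Finite.of_injective (fun σ : R ≃ₐ[k] R => (σ : R → R))
      DFunLike.coe_injective
    have hp : ∀ n : ℕ, x ^ 2 ∣ (σ ^ n) x - x := by
      intro n
      induction n with
      | zero => simp
      | succ n ih =>
        have h1 : x ^ 2 ∣ σ ((σ ^ n) x - x) := h.pres (φ := (σ : R →ₐ[k] R)) hσ ih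
        have h2 := dvd_add h1 hσ
        rw [map_sub] at h2
        rw [pow_succ' σ n, AlgEquiv.mul_apply]
        rwa [sub_add_sub_cancel] at h2
    have := hp (orderOf σ - 1)
    have e : σ ^ (orderOf σ - 1) = σ⁻¹ := by
      rw [eq_inv_iff_mul_eq_one, ← pow_succ, Nat.sub_add_cancel (orderOf_pos σ), pow_orderOf_eq_one]
    rwa [e] at this

theorem mem_Nott (h : TR k R x N) [Finite R] (σ : R ≃ₐ[k] R) :
    σ ∈ Nott h ↔ x ^ 2 ∣ σ x - x := Iff.rfl

theorem TR.exists_aut (h : TR k R x N) [Finite R] (_hN : 2 ≤ N) {y : R} (hy : x ^ 2 ∣ y - x) :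
    ∃ σ ∈ Nott h, σ x = y := by
  have hyN : y ^ N = 0 := by
    obtain ⟨c, hc⟩ := hy
    have : y = x * (1 + x * c) := by linear_combination hc
    rw [this, mul_pow, h.nil, zero_mul]
  obtain ⟨φ, hφ⟩ := h.lift y hyN
  have hinj : Function.Injective φ := by
    rw [injective_iff_map_eq_zero]
    intro r hr
    have : ∀ i, x ^ i ∣ r := by
      intro i
      induction i with
      | zero => simp
      | succ i ih =>
        have h1 := h.filt φ (m := 1) (by rw [hφ]; exact hy) ih
        rw [hr, zero_sub, dvd_neg, add_comm] at h1
        exact h1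
    have h2 := this N
    rw [h.nil] at h2
    exact zero_dvd_iff.mp h2
  refine ⟨AlgEquiv.ofBijective φ (Finite.injective_iff_bijective.mp hinj), ?_, ?_⟩
  · rw [mem_Nott]
    simpa [hφ] using hy
  · simpa using hφ

theorem TR.comm_PP (h : TR k R x N) [Finite R] {σ τ : R ≃ₐ[k] R} (hσ : σ ∈ Nott h) (hτ : τ ∈ Nott h)
    {m l : ℕ} {a b : k} (h1 : PP x σ (m + 1) a) (h2 : PP x τ (l + 1) b) :
    PP x (⁅σ⁻¹, τ⁻¹⁆ : R ≃ₐ[k] R) (m + l + 2) (a * b * ((l : k) - m)) := by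
  obtain ⟨c, hc⟩ := h.comm (φ := (σ : R →ₐ[k] R)) (ψ := (τ : R →ₐ[k] R)) h1 h2
  set g : R ≃ₐ[k] R := (τ * σ)⁻¹ with hg
  have hgm : g ∈ Nott h := (Nott h).inv_mem ((Nott h).mul_mem hτ hσ)
  have e1 : (⁅σ⁻¹, τ⁻¹⁆ : R ≃ₐ[k] R) = g * (σ * τ) := by
    rw [hg, commutatorElement_def]; group
  have e2 : (⁅σ⁻¹, τ⁻¹⁆ : R ≃ₐ[k] R) x = g (σ (τ x)) := by rw [e1]; rfl
  have e3 : g (τ (σ x)) = x := by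
    have : (g * (τ * σ)) x = x := by rw [hg, inv_mul_cancel]; rfl
    exact this
  have hc' : σ (τ x) = τ (σ x) + (algebraMap k R (a * b * ((l : k) - m)) * x ^ (m + l + 3) +
      x ^ (m + l + 4) * c) := by
    have hc2 : σ (τ x) - τ (σ x) - algebraMap k R (a * b * ((l : k) - m)) * x ^ (m + l + 3) =
      x ^ (m + l + 4) * c := hc
    linear_combination hc2
  have f1 := h.filt (g : R →ₐ[k] R) (m := 1) hgm (dvd_refl (x ^ (m + l + 3)))
  have f2 := h.pres (φ := (g : R →ₐ[k] R)) hgm (dvd_mul_right (x ^ (m + l + 4)) c)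
  obtain ⟨u, hu⟩ := f1
  obtain ⟨v, hv⟩ := f2
  have hu2 : g (x ^ (m + l + 3)) - x ^ (m + l + 3) = x ^ (1 + (m + l + 3)) * u := hu
  have hv2 : g (x ^ (m + l + 4) * c) = x ^ (m + l + 4) * v := hv
  unfold PP
  rw [e2, hc', map_add, e3, map_add, map_mul g (algebraMap k R _), AlgEquiv.commutes, hv2]
  refine ⟨algebraMap k R (a * b * ((l : k) - m)) * u + v, ?_⟩
  linear_combination algebraMap k R (a * b * ((l : k) - m)) * hu2

theorem TR.deep (h : TR k R x N) [Finite R] (hN2 : 2 ≤ N) {p d : ℕ} [CharP k p] (hp : 2 ^ d < p) (i : ℕ) :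
    ∀ m, 2 ^ (i + 1) - 1 ≤ m → m ≤ 2 ^ d - 1 →
      ∃ σ ∈ derivedSeries (Nott h) i, ∃ a : k, a ≠ 0 ∧ PP x (σ : R ≃ₐ[k] R) m a := by
  induction i with
  | zero =>
    intro m hm _
    obtain ⟨σ, hσ, hx⟩ := h.exists_aut hN2 (y := x + x ^ (m + 1))
      (by rw [add_sub_cancel_left]; exact pow_dvd_pow x (by omega))
    refine ⟨⟨σ, hσ⟩, by rw [derivedSeries_zero]; exact Subgroup.mem_top _, 1, one_ne_zero, ?_⟩
    unfold PP
    simp [hx]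
  | succ i ih =>
    intro m hm hmd
    have hpow : 2 ^ (i + 1 + 1) = 2 * 2 ^ (i + 1) := by rw [pow_succ]; ring
    have hpow1 : 2 ≤ 2 ^ (i + 1) := by rw [pow_succ]; have := Nat.one_le_two_pow (n := i); omega
    obtain ⟨m', hm'⟩ : ∃ m', 2 ^ (i + 1) - 1 = m' + 1 := ⟨2 ^ (i + 1) - 2, by omega⟩
    obtain ⟨l, hl⟩ : ∃ l, m = m' + l + 2 := ⟨m - m' - 2, by omega⟩
    obtain ⟨σ, hσ, a, ha, hσP⟩ := ih (m' + 1) (by omega) (by omega)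
    obtain ⟨τ, hτ, b, hb, hτP⟩ := ih (l + 1) (by omega) (by omega)
    refine ⟨⁅σ⁻¹, τ⁻¹⁆, ?_, a * b * ((l : k) - m'), ?_, ?_⟩
    · rw [derivedSeries_succ]
      exact Subgroup.commutator_mem_commutator (Subgroup.inv_mem _ hσ) (Subgroup.inv_mem _ hτ)
    · refine mul_ne_zero (mul_ne_zero ha hb) ?_
      have hlm : m' < l := by omega
      rw [← Nat.cast_sub hlm.le, Ne, CharP.cast_eq_zero_iff k p]
      intro hdv
      have := Nat.le_of_dvd (by omega) hdv
      omega
    · rw [hl]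
      have := h.comm_PP σ.2 τ.2 hσP hτP
      exact this

theorem TR.card (h : TR k R x N) [Finite R] [Finite k] (hN : 2 ≤ N) :
    ∃ e ≤ N - 2, Nat.card (Nott h) = Nat.card k ^ e := by
  set W : Submodule k R := (LinearMap.mulLeft k (x ^ 2)).range with hW
  have hmem : ∀ r, r ∈ W ↔ x ^ 2 ∣ r := by
    intro r
    rw [hW, LinearMap.mem_range]
    exact ⟨fun ⟨y, hy⟩ => ⟨y, by rw [← hy]; simp⟩, fun ⟨y, hy⟩ => ⟨y, by rw [hy]; simp⟩⟩
  refine ⟨Module.finrank k W, ?_, ?_⟩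
  · have hle : W ≤ (degreeLT k (N - 2)).map
        ((LinearMap.mulLeft k (x ^ 2)).comp (aeval x : k[X] →ₐ[k] R).toLinearMap) := by
      intro r hr
      obtain ⟨y, rfl⟩ := hr
      obtain ⟨f, rfl⟩ := h.gen y
      refine ⟨f %ₘ (X ^ (N - 2)), ?_, ?_⟩
      · rw [SetLike.mem_coe, mem_degreeLT]
        have := degree_modByMonic_lt f (monic_X_pow (R := k) (N - 2))
        rwa [degree_X_pow] at this
      · have e := modByMonic_add_div f (X ^ (N - 2) : k[X])
        conv_rhs => rw [← e]
        simp only [LinearMap.comp_apply, AlgHom.toLinearMap_apply, LinearMap.mulLeft_apply, map_add,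
          map_mul, map_pow, aeval_X]
        rw [← mul_assoc, ← pow_add, show 2 + (N - 2) = N by omega, h.nil]
        simp
    have hf : Module.Finite k (degreeLT k (N - 2)) := inferInstance
    calc Module.finrank k W ≤ _ := Submodule.finrank_mono hle
      _ ≤ Module.finrank k (degreeLT k (N - 2)) := Submodule.finrank_map_le _ _
      _ = N - 2 := by rw [(degreeLTEquiv k (N - 2)).finrank_eq]; simp
  · rw [← Module.natCard_eq_pow_finrank (K := k) (V := W)]
    refine Nat.card_congr (Equiv.ofBijective
      (fun σ : Nott h => (⟨(σ : R ≃ₐ[k] R) x - x, (hmem _).mpr σ.2⟩ : W)) ⟨?_, ?_⟩)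
    · intro σ τ hst
      have hst' : (σ : R ≃ₐ[k] R) x = (τ : R ≃ₐ[k] R) x := by
        have := congrArg Subtype.val hst
        simpa using this
      apply Subtype.ext
      apply AlgEquiv.ext
      intro r
      obtain ⟨f, rfl⟩ := h.gen r
      rw [← aeval_algHom_apply, ← aeval_algHom_apply, hst']
    · rintro ⟨w, hw⟩
      obtain ⟨σ, hσ, hx⟩ := h.exists_aut hN (y := x + w) (by rw [add_sub_cancel_left]; exact (hmem w).mp hw)
      exact ⟨⟨σ, hσ⟩, Subtype.ext (by simp [hx])⟩

end

theorem exists_group (d : ℕ) (hd : 1 ≤ d) : ∃ (G : Type) (_ : Group G) (_ : Finite G),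
    Group.IsSolvable G ∧ Odd (Nat.card G) ∧
      (derivedSeries G d = ⊥ ∧ ∀ k < d, derivedSeries G k ≠ ⊥) ∧
      (Nat.card G).primeFactorsList.length ≤ 2 ^ d - 1 := by
  obtain ⟨p, hpd, hp⟩ := Nat.exists_infinite_primes (2 ^ d + 1)
  have hF : Fact p.Prime := ⟨hp⟩
  have h2d : 2 ≤ 2 ^ d := by
    calc 2 = 2 ^ 1 := rfl
      _ ≤ 2 ^ d := Nat.pow_le_pow_right (by norm_num) hd
  have hodd : Odd p := hp.odd_of_ne_two (by omega)
  have h := TR_adjoin (ZMod p) (2 ^ d + 1) (by omega)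
  have hfin : Module.Finite (ZMod p) (AdjoinRoot (X ^ (2 ^ d + 1) : (ZMod p)[X])) :=
    (monic_X_pow (2 ^ d + 1)).finite_adjoinRoot
  have hfinR : Finite (AdjoinRoot (X ^ (2 ^ d + 1) : (ZMod p)[X])) :=
    Module.finite_of_finite (ZMod p)
  obtain ⟨e, he, hcard⟩ := h.card (by omega)
  rw [Nat.card_zmod] at hcard
  set G := Nott h with hG
  have hGf : Finite G := Nat.finite_of_card_ne_zero (by rw [hcard]; exact pow_ne_zero _ hp.ne_zero)
  have hpg : IsPGroup p G := IsPGroup.of_card hcard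
  have hnil : Group.IsNilpotent G := hpg.isNilpotent
  have hsol : Group.IsSolvable G := inferInstance
  have hne : derivedSeries G (d - 1) ≠ ⊥ := by
    intro hb
    obtain ⟨σ, hσ, a, ha, hP⟩ := h.deep (p := p) (by omega) (d := d) (by omega) (d - 1) (2 ^ d - 1)
      (by rw [Nat.sub_add_cancel hd]) le_rfl
    have hb' : derivedSeries (Nott h) (d - 1) = ⊥ := hb
    rw [hb', Subgroup.mem_bot] at hσ
    subst hσ
    unfold PP at hP
    rw [show 2 ^ d - 1 + 2 = 2 ^ d + 1 by omega, h.nil, zero_dvd_iff,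
      show 2 ^ d - 1 + 1 = 2 ^ d + 1 - 1 by omega] at hP
    have h3 : algebraMap (ZMod p) (AdjoinRoot (X ^ (2 ^ d + 1) : (ZMod p)[X])) a *
        (AdjoinRoot.root (X ^ (2 ^ d + 1) : (ZMod p)[X])) ^ (2 ^ d + 1 - 1) = 0 := by
      simpa using hP
    rw [← Algebra.smul_def, smul_eq_zero_iff_right ha] at h3
    exact h.ne h3
  set D := derivedSeries G d with hD
  have hlt : D < derivedSeries G (d - 1) := by
    have := Group.IsSolvable.commutator_lt_of_ne_bot hne
    rwa [← derivedSeries_succ, Nat.sub_add_cancel hd] at this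
  have hdvd : Nat.card (G ⧸ D) ∣ p ^ e := by
    rw [← hcard]
    exact Subgroup.card_quotient_dvd_card D
  obtain ⟨e', he', hcard'⟩ := (Nat.dvd_prime_pow hp).mp hdvd
  refine ⟨G ⧸ D, inferInstance, inferInstance, inferInstance, ?_, ⟨?_, ?_⟩, ?_⟩
  · rw [hcard']; exact hodd.pow
  · rw [← mk_derived, Subgroup.map_eq_bot_iff, QuotientGroup.ker_mk']
  · intro j hj hjb
    rw [← mk_derived, Subgroup.map_eq_bot_iff, QuotientGroup.ker_mk'] at hjb
    have : derivedSeries G (d - 1) ≤ derivedSeries G j := derivedSeries_antitone G (by omega)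
    exact absurd hlt (not_lt_of_ge (this.trans hjb))
  · rw [hcard', hp.primeFactorsList_pow, List.length_replicate]
    omega

end OddSol

/-- If `c₀` is the minimal composition length of a finite solvable group of odd order
with derived length `d ≥ 1`, then `log₂ c₀ < d < (γ₀+1)·log₂ c₀ + 2`,
where `γ₀ = 2·log₇ 2`. -/
theorem odd_solvable_min_comp_length_bounds (d c₀ : ℕ) (hd : 1 ≤ d)
    (hc : IsLeast {m : ℕ | ∃ (G : Type) (_ : Group G) (_ : Finite G),
      IsSolvable G ∧ Odd (Nat.card G) ∧ DerivedLengthEq G d ∧ Omega (Nat.card G) = m} c₀) :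
    Real.logb 2 c₀ < d ∧ (d : ℝ) < (2 * Real.logb 7 2 + 1) * Real.logb 2 c₀ + 2 := by
  obtain ⟨⟨G, hG, hGf, hsol, hodd, ⟨h0, h1⟩, hom⟩, hmin⟩ := hc
  constructor
  · obtain ⟨G', hG', hGf', hsol', hodd', hder, hle⟩ := OddSol.exists_group d hd
    have hc0 : c₀ ≤ 2 ^ d - 1 := (hmin ⟨G', hG', hGf', hsol', hodd', hder, rfl⟩).trans hle
    have hp : 0 < 2 ^ d := Nat.two_pow_pos d
    rcases Nat.eq_zero_or_pos c₀ with rfl | hpos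
    · have : (0 : ℝ) < d := by exact_mod_cast hd
      simpa using this
    · have hlt : (c₀ : ℝ) < (2 : ℝ) ^ d := by
        have : c₀ < 2 ^ d := by omega
        exact_mod_cast this
      have h2 := Real.logb_lt_logb (b := 2) (by norm_num) (by exact_mod_cast hpos) hlt
      rwa [Real.logb_pow, Real.logb_self_eq_one (by norm_num), mul_one] at h2
  · have hs : Group.IsSolvable G := hsol
    have hn : OddSol.om (⊤ : Subgroup G) = c₀ := by
      rw [← hom]
      unfold OddSol.om Omega
      rw [ArithmeticFunction.cardFactors_apply, Subgroup.card_top]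
    rcases OddSol.group_bound hodd hd h0 h1 with h | ⟨a, b, l, rfl, hl, h7, h⟩
    · rw [hn] at h
      exact OddSol.real_bound1 hd h
    · rw [hn] at h
      exact OddSol.real_bound2 hl h7 h
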